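/- arXiv:2110.12675 — 15 statements merged into one kernel-verified Lean document; each statement's English description precedes it below -/
import Mathlib

section
/- Let K be a field, θ : K → K a ring homomorphism with θ ≠ id_K, and δ : K → K a θ-derivation, i.e. an additive map satisfying δ(ab) = θ(a)·δ(b) + δ(a)·b for all a, b ∈ K. Then there exists an element a ∈ K such that δ(x) = a·(θ(x) − x) for all x ∈ K. -/
/-- Every `θ`-derivation of a field `K` with `θ ≠ id` is of the form
`x ↦ a * (θ x - x)` for some `a ∈ K`. -/
theorem theta_derivation_eq_scalar_mul_delta0
    (K : Type*) [Field K] (θ : K →+* K) (hθ : θ ≠ RingHom.id K)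
    (δ : K → K)
    (hadd : ∀ a b : K, δ (a + b) = δ a + δ b)
    (hleib : ∀ a b : K, δ (a * b) = θ a * δ b + δ a * b) :
    ∃ a : K, ∀ x : K, δ x = a * (θ x - x) := by
  obtain ⟨c, hc⟩ : ∃ c, θ c ≠ c := by
    by_contra! h
    exact hθ (RingHom.ext h)
  have hc' : θ c - c ≠ 0 := sub_ne_zero.mpr hc
  refine ⟨δ c / (θ c - c), fun x => ?_⟩
  have h : θ c * δ x + δ c * x = θ x * δ c + δ x * c := by
    rw [← hleib, ← hleib, mul_comm]
  rw [div_mul_eq_mul_div, eq_div_iff hc']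
  linear_combination h
end

section
/- Let p be a prime, K a field of characteristic p, δ : K → K a nonzero derivation, and F = {x ∈ K : δ(x) = 0} the subfield of constants; assume the extension K/F is finite. Then there exists r ≥ 1 such that [K:F] = p^r, there exist unique elements z_0, …, z_{r−1} ∈ F such that δ^{p^r} + z_{r−1}·δ^{p^{r−1}} + ⋯ + z_1·δ^p + z_0·δ = 0 as additive maps K → K, and the family (δ^i)_{0 ≤ i < p^r} is linearly independent over K, i.e. if a_0, …, a_{p^r−1} ∈ K satisfy Σ_{i<p^r} a_i·δ^i(x) = 0 for all x ∈ K then all a_i = 0. -/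
open Finset

theorem Derivation.iterate_mul {R A : Type*} [CommSemiring R] [CommSemiring A] [Algebra R A]
    (D : Derivation R A A) (n : ℕ) (x y : A) :
    D^[n] (x * y) = ∑ ij ∈ antidiagonal n, n.choose ij.1 • (D^[ij.1] x * D^[ij.2] y) := by
  induction n with
  | zero => simp
  | succ n ih =>
    rw [Finset.sum_antidiagonal_choose_succ_nsmul (fun i j => D^[i] x * D^[j] y),
      Function.iterate_succ_apply', ih, map_sum, ← Finset.sum_add_distrib]
    refine Finset.sum_congr rfl fun ij h => ?_
    rw [D.map_smul_of_tower]
    have : n.choose ij.1 = n.choose ij.2 := Nat.choose_symm_of_eq_add (mem_antidiagonal.1 h).symm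
    simp only [D.leibniz, Function.iterate_succ_apply', smul_eq_mul, nsmul_eq_mul, ← this]
    ring

theorem exists_eq_pow_of_dvd_choose {p : ℕ} (hp : p.Prime) {n : ℕ} (hn : n ≠ 0)
    (h : ∀ j, 0 < j → j < n → p ∣ n.choose j) : ∃ r, n = p ^ r := by
  have := Fact.mk hp
  induction n using Nat.strong_induction_on with
  | _ n ih =>
    obtain rfl | h1 : n = 1 ∨ 1 < n := by lia
    · exact ⟨0, by simp⟩
    obtain ⟨m, rfl⟩ : p ∣ n := by simpa using h 1 one_pos h1
    have hm : m ≠ 0 := by rintro rfl; simp at hn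
    obtain ⟨r, rfl⟩ := ih m (by nlinarith [hp.two_le, Nat.pos_of_ne_zero hm]) hm
      fun j hj hjm => by
        have h2 := h (p * j) (Nat.mul_pos hp.pos hj) (by nlinarith [hp.two_le])
        have h3 := Choose.choose_modEq_choose_mod_mul_choose_div_nat
          (p := p) (n := p * m) (k := p * j)
        simp [Nat.mul_div_cancel_left _ hp.pos] at h3
        exact (h3.dvd_iff dvd_rfl).1 h2
    exact ⟨r + 1, by ring⟩

theorem Derivation.iterate_mul_eq_sum_range {R A : Type*} [CommSemiring R] [CommSemiring A]
    [Algebra R A] (D : Derivation R A A) {n N : ℕ} (h : n < N) (x y : A) :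
    D^[n] (x * y) = ∑ j ∈ range N, n.choose j * D^[n - j] x * D^[j] y := by
  rw [mul_comm, D.iterate_mul, Finset.Nat.sum_antidiagonal_eq_sum_range_succ
    (fun i j => n.choose i • (D^[i] y * D^[j] x))]
  refine (Finset.sum_congr rfl fun j _ => ?_).trans
    (Finset.sum_subset (range_subset_range.2 h) fun j _ hj => ?_)
  · rw [nsmul_eq_mul]
    ring
  · simp [Nat.choose_eq_zero_of_lt (show n < j by simpa using hj)]

theorem Derivation.sum_mul_iterate_mul {R A : Type*} [CommSemiring R] [CommSemiring A]
    [Algebra R A] (D : Derivation R A A) (N : ℕ) (a : ℕ → A) (x y : A) :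
    ∑ i ∈ range N, a i * D^[i] (x * y) =
      ∑ j ∈ range N, (∑ i ∈ range N, a i * (i.choose j * D^[i - j] x)) * D^[j] y := by
  simp only [Finset.sum_mul]
  rw [Finset.sum_comm]
  refine Finset.sum_congr rfl fun i hi => ?_
  rw [D.iterate_mul_eq_sum_range (mem_range.1 hi), Finset.mul_sum]
  exact Finset.sum_congr rfl fun j _ => by ring

section Field

variable {F K : Type*} [Field F] [Field K] [Algebra F K] [FiniteDimensional F K]
  (D : Derivation F K K)

/-- The solution space of a linear differential equation of order `m` has dimension at most `m`
over the field of constants. -/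
theorem Derivation.finrank_le_of_sum_mul_iterate_eq_zero
    (hF : ∀ x, D x = 0 → x ∈ (algebraMap F K).range) (m : ℕ) (a : ℕ → K) (ha : a m ≠ 0)
    (V : Submodule F K) (hV : ∀ x ∈ V, ∑ i ∈ range (m + 1), a i * D^[i] x = 0) :
    Module.finrank F V ≤ m := by
  induction m generalizing a V with
  | zero =>
    have : V = ⊥ := (Submodule.eq_bot_iff V).2 fun x hx => by simpa [ha] using hV x hx
    simp [this]
  | succ m ih =>
    by_cases hbot : V = ⊥
    · rw [hbot, finrank_bot]
      exact Nat.zero_le _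
    obtain ⟨u, huV, hu⟩ := V.ne_bot_iff.1 hbot
    let f : V →ₗ[F] K := D.toLinearMap ∘ₗ LinearMap.mulLeft F u⁻¹ ∘ₗ V.subtype
    have hf (x : V) : f x = D (u⁻¹ * x) := rfl
    let b (j : ℕ) : K := ∑ i ∈ range (m + 2), a i * (i.choose j * D^[i - j] u)
    have hb0 : b 0 = 0 := by simpa [b] using hV u huV
    have hbm : b (m + 1) = a (m + 1) * u := by
      have : ∀ i ∈ range (m + 1), a i * ((i.choose (m + 1) : K) * D^[i - (m + 1)] u) = 0 :=
        fun i hi => by simp [Nat.choose_eq_zero_of_lt (mem_range.1 hi)]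
      simp [b, Finset.sum_range_succ _ (m + 1), Finset.sum_eq_zero this]
    have hrange : Module.finrank F f.range ≤ m := by
      refine ih (fun j => b (j + 1)) (by simp [hbm, ha, hu]) _ ?_
      rintro _ ⟨x, rfl⟩
      have h := hV x x.2
      rw [← mul_inv_cancel_left₀ hu (x : K), D.sum_mul_iterate_mul, Finset.sum_range_succ'] at h
      change ∑ j ∈ range (m + 1), b (j + 1) * _ + b 0 * _ = 0 at h
      simpa [hb0, hf] using h
    have hker : Module.finrank F f.ker ≤ 1 := by
      refine finrank_le_one ⟨⟨u, huV⟩, by simp [hf, hu]⟩ ?_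
      rintro ⟨x, hx⟩
      obtain ⟨c, hc⟩ := hF _ hx
      refine ⟨c, Subtype.ext (Subtype.ext ?_)⟩
      simp [Algebra.smul_def, hc, hu, mul_right_comm]
    have := f.finrank_range_add_finrank_ker
    lia

theorem Derivation.eq_zero_of_sum_mul_iterate_eq_zero
    (hF : ∀ x, D x = 0 → x ∈ (algebraMap F K).range) {m : ℕ} (hm : m ≤ Module.finrank F K)
    (a : ℕ → K) (h : ∀ x, ∑ i ∈ range m, a i * D^[i] x = 0) : ∀ i < m, a i = 0 := by
  induction m with
  | zero => simp
  | succ m ih =>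
    have ham : a m = 0 := by
      by_contra ham
      have := D.finrank_le_of_sum_mul_iterate_eq_zero hF m a ham ⊤ fun x _ => h x
      rw [finrank_top] at this
      lia
    intro i hi
    obtain rfl | hi := Nat.lt_succ_iff_lt_or_eq.1 hi |>.symm
    · exact ham
    · exact ih (by lia) (fun x => by simpa [Finset.sum_range_succ, ham] using h x) i hi

theorem Derivation.exists_sum_mul_iterate_eq_zero
    (hF : ∀ x, D x = 0 → x ∈ (algebraMap F K).range) :
    ∃ a : ℕ → K, a (Module.finrank F K) = 1 ∧
      ∀ x, ∑ i ∈ range (Module.finrank F K + 1), a i * D^[i] x = 0 := by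
  set n := Module.finrank F K with hn
  have hdep : ¬ LinearIndependent K
      fun i : Fin (n + 1) => ((D : K →ₗ[F] K) ^ (i : ℕ) : K →ₗ[F] K) := fun h => by
    have := h.fintype_card_le_finrank
    rw [Module.finrank_linearMap_self, Fintype.card_fin] at this
    lia
  obtain ⟨g, hg, i, hi⟩ := Fintype.not_linearIndependent_iff.1 hdep
  let c (i : ℕ) : K := if h : i < n + 1 then g ⟨i, h⟩ else 0
  have hcg (i : Fin (n + 1)) : c i = g i := dif_pos i.2
  have hc (x : K) : ∑ i ∈ range (n + 1), c i * D^[i] x = 0 := by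
    rw [Finset.sum_range]
    simpa [hcg, LinearMap.sum_apply, Module.End.pow_apply] using LinearMap.congr_fun hg x
  have hcn : c n ≠ 0 := fun hcn => hi <| by
    have h0 := D.eq_zero_of_sum_mul_iterate_eq_zero hF hn.le c
      fun x => by simpa [Finset.sum_range_succ, hcn] using hc x
    rw [← hcg]
    obtain h | h := Nat.lt_succ_iff_lt_or_eq.1 i.2
    · exact h0 i h
    · rw [h, hcn]
  refine ⟨fun i => (c n)⁻¹ * c i, inv_mul_cancel₀ hcn, fun x => ?_⟩
  simp_rw [mul_assoc, ← Finset.mul_sum, hc, mul_zero]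

/-- The coefficients of a monic differential equation of order `[K:F]` satisfied by every element of
`K` are constants. -/
theorem Derivation.apply_coeff_eq_zero
    (hF : ∀ x, D x = 0 → x ∈ (algebraMap F K).range) (a : ℕ → K)
    (han : a (Module.finrank F K) = 1)
    (h : ∀ x, ∑ i ∈ range (Module.finrank F K + 1), a i * D^[i] x = 0) :
    ∀ i ≤ Module.finrank F K, D (a i) = 0 := by
  have key := D.eq_zero_of_sum_mul_iterate_eq_zero hF le_rfl (fun i => D (a i)) fun x => by
    have h1 := congrArg D (h x)
    have h2 := h (D x)
    simp only [map_sum, D.leibniz, smul_eq_mul, Finset.sum_add_distrib, map_zero] at h1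
    simp only [← Function.iterate_succ_apply, Function.iterate_succ_apply'] at h2
    rw [h2, zero_add, Finset.sum_range_succ, han, D.map_one_eq_zero] at h1
    simpa [mul_comm] using h1
  intro i hi
  obtain rfl | hi := hi.eq_or_lt
  · simp [han]
  · exact key i hi

/-- A monic differential operator of order `[K:F]` annihilating `K` is additive with respect to the
comultiplication: expanding it on `y * x` produces no mixed terms. -/
theorem Derivation.coeff_mul_choose_eq_zero
    (hF : ∀ x, D x = 0 → x ∈ (algebraMap F K).range) (a : ℕ → K)
    (han : a (Module.finrank F K) = 1)
    (h : ∀ x, ∑ i ∈ range (Module.finrank F K + 1), a i * D^[i] x = 0)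
    {i j : ℕ} (hj : 0 < j) (hji : j < i) (hi : i ≤ Module.finrank F K) :
    a i * i.choose j = 0 := by
  set n := Module.finrank F K with hn
  have hcoeff (y : K) : ∑ i ∈ range (n + 1), a i * (i.choose j * D^[i - j] y) = a j * y := by
    let b (j : ℕ) : K := ∑ i ∈ range (n + 1), a i * (i.choose j * D^[i - j] y)
    have hbn : b n = y := by
      have : ∀ i ∈ range n, a i * ((i.choose n : K) * D^[i - n] y) = 0 :=
        fun i hi => by simp [Nat.choose_eq_zero_of_lt (mem_range.1 hi)]
      simp [b, Finset.sum_range_succ _ n, Finset.sum_eq_zero this, han]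
    refine sub_eq_zero.1 (D.eq_zero_of_sum_mul_iterate_eq_zero hF hn.le
      (fun j => b j - a j * y) (fun x => ?_) j (hji.trans_le hi))
    have h1 := h (y * x)
    rw [D.sum_mul_iterate_mul] at h1
    change ∑ j ∈ range (n + 1), b j * _ = 0 at h1
    have h2 : ∑ j ∈ range (n + 1), (b j - a j * y) * D^[j] x = 0 := by
      simp_rw [sub_mul, Finset.sum_sub_distrib, h1, mul_right_comm _ y, ← Finset.sum_mul]
      rw [h, zero_mul, sub_zero]
    simpa [Finset.sum_range_succ _ n, hbn, han] using h2
  have key := D.eq_zero_of_sum_mul_iterate_eq_zero hF (m := n + 1 - j) (by lia)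
    (fun k => a (k + j) * (k + j).choose j - if k = 0 then a j else 0) fun y => by
      have h1 := hcoeff y
      have h2 : ∀ i ∈ range j, a i * ((i.choose j : K) * D^[i - j] y) = 0 :=
        fun i hi => by simp [Nat.choose_eq_zero_of_lt (mem_range.1 hi)]
      rw [show n + 1 = j + (n + 1 - j) by lia, Finset.sum_range_add, Finset.sum_eq_zero h2,
        zero_add] at h1
      have hpos : 0 < n + 1 - j := by lia
      simp only [sub_mul, Finset.sum_sub_distrib, ite_mul, zero_mul, Finset.sum_ite_eq',
        mem_range, hpos, if_true, Function.iterate_zero, id]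
      rw [← h1, sub_eq_zero]
      refine Finset.sum_congr rfl fun k _ => ?_
      rw [add_comm j k, Nat.add_sub_cancel, mul_assoc]
  have := key (i - j) (by lia)
  simpa [Nat.sub_add_cancel hji.le, Nat.sub_ne_zero_of_lt hji] using this

end Field


/-- For a nonzero derivation `δ` of a field `K` of characteristic `p` whose field of
constants `F` has finite index, the degree `[K:F]` is a power `p^r` with `r ≥ 1`,
there exist unique `z_0, …, z_{r-1} ∈ F` with
`δ^{p^r} + z_{r-1} δ^{p^{r-1}} + ⋯ + z_0 δ = 0`, and the iterates
`δ^i` for `0 ≤ i < p^r` are linearly independent over `K`. -/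
theorem minimal_polynomial_of_derivation
    (p : ℕ) (hp : p.Prime) (K : Type*) [Field K] [CharP K p]
    (δ : K → K)
    (hadd : ∀ a b : K, δ (a + b) = δ a + δ b)
    (hleib : ∀ a b : K, δ (a * b) = a * δ b + δ a * b)
    (hδ : δ ≠ 0)
    (F : Subfield K) (hF : ∀ x : K, x ∈ F ↔ δ x = 0)
    [FiniteDimensional F K] :
    ∃ r : ℕ, 1 ≤ r ∧ Module.finrank F K = p ^ r ∧
      (∃! z : Fin r → F, ∀ x : K,
        δ^[p ^ r] x + ∑ i : Fin r, (z i : K) * δ^[p ^ (i : ℕ)] x = 0) ∧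
      (∀ a : Fin (p ^ r) → K,
        (∀ x : K, ∑ i : Fin (p ^ r), a i * δ^[(i : ℕ)] x = 0) →
        ∀ i, a i = 0) := by
  let D : Derivation F K K := Derivation.mk'
    { toFun := δ
      map_add' := hadd
      map_smul' := fun c x => by
        simp [Subfield.smul_def, hleib, (hF c).1 c.2] }
    fun a b => by simp [hleib, mul_comm]
  have hD : (D : K → K) = δ := rfl
  have hconst (x : K) (hx : D x = 0) : x ∈ (algebraMap F K).range := ⟨⟨x, (hF x).2 hx⟩, rfl⟩
  obtain ⟨a, han, ha⟩ := D.exists_sum_mul_iterate_eq_zero hconst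
  have haD := D.apply_coeff_eq_zero hconst a han ha
  have hchoose {i j : ℕ} := D.coeff_mul_choose_eq_zero hconst a han ha (i := i) (j := j)
  have hpow {i : ℕ} (hi : i ≤ Module.finrank F K) (hai : a i ≠ 0) : ∃ k, i = p ^ k := by
    refine exists_eq_pow_of_dvd_choose hp ?_ fun j hj hji => ?_
    · rintro rfl
      have h1 := ha 1
      rw [Finset.sum_range_succ'] at h1
      have h2 (k : ℕ) : D^[k] 0 = 0 := Function.iterate_fixed (map_zero D) k
      simp [h2, hai] at h1
    · exact (CharP.cast_eq_zero_iff K p _).1 ((mul_eq_zero_iff_left hai).1 (hchoose hj hji hi))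
  obtain ⟨r, hr⟩ := hpow le_rfl (by simp [han])
  have hindep {c : ℕ → K} := D.eq_zero_of_sum_mul_iterate_eq_zero hconst le_rfl c
  rw [hr] at han ha haD hpow hindep
  rw [hD] at ha hindep
  have hfin (c : Fin (p ^ r) → K) (hc : ∀ x, ∑ i, c i * δ^[(i : ℕ)] x = 0) (i) : c i = 0 := by
    have := hindep (c := fun k => if h : k < p ^ r then c ⟨k, h⟩ else 0)
      (fun x => by simpa [Finset.sum_range] using hc x) i i.2
    simpa using this
  have hinj : Function.Injective fun k : ℕ => p ^ k := Nat.pow_right_injective hp.two_le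
  have hli : LinearIndependent K fun i : Fin r => δ^[p ^ (i : ℕ)] :=
    (Fintype.linearIndependent_iff.2 fun c hc => hfin c fun x => by
      simpa using congrFun hc x : LinearIndependent K fun k : Fin (p ^ r) => δ^[(k : ℕ)]).comp
      (fun i : Fin r => ⟨p ^ (i : ℕ), Nat.pow_lt_pow_right hp.one_lt i.2⟩)
      fun i j hij => Fin.ext (hinj (Fin.mk.inj hij))
  refine ⟨r, Nat.one_le_iff_ne_zero.2 ?_, hr, ?_, hfin⟩
  · rintro rfl
    refine hδ (funext fun x => (hF x).1 ?_)
    obtain ⟨c, hc⟩ := (finrank_eq_one_iff_of_nonzero' (1 : K) one_ne_zero).1 (by simpa using hr) x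
    rw [← hc]
    simp [Subfield.smul_def]
  · have hz : ∀ x, δ^[p ^ r] x + ∑ i : Fin r, a (p ^ (i : ℕ)) * δ^[p ^ (i : ℕ)] x = 0 :=
        fun x => by
      rw [← ha x, Finset.sum_range_succ, han, one_mul, add_comm, add_left_inj,
        Fin.sum_univ_eq_sum_range (fun i => a (p ^ i) * δ^[p ^ i] x),
        ← Finset.sum_image (f := fun k => a k * δ^[k] x) hinj.injOn]
      refine Finset.sum_subset (fun k hk => ?_) fun k hk hk' => ?_
      · obtain ⟨i, hi, rfl⟩ := Finset.mem_image.1 hk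
        exact mem_range.2 (Nat.pow_lt_pow_right hp.one_lt (mem_range.1 hi))
      · by_contra hne
        obtain ⟨i, rfl⟩ := hpow (mem_range.1 hk).le (left_ne_zero_of_mul hne)
        exact hk' (Finset.mem_image_of_mem _
          (mem_range.2 ((Nat.pow_lt_pow_iff_right hp.one_lt).1 (mem_range.1 hk))))
    refine ⟨fun i => ⟨a (p ^ (i : ℕ)), (hF _).2 (haD _ (Nat.pow_le_pow_right hp.pos i.2.le))⟩,
      hz, fun z hz' => funext fun i => Subtype.ext <| sub_eq_zero.1 <|
        Fintype.linearIndependent_iff.1 hli (fun i => z i - a (p ^ (i : ℕ))) (funext fun x => ?_) i⟩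
    simpa [sub_mul, sub_eq_zero] using (hz' x).trans (hz x).symm
end

section
/- Let K be a field and θ : K → K a ring automorphism of finite order s ≥ 2, with fixed field F, and let c ∈ K be nonzero. Then for every F-linear map f : K → K there exists a unique tuple (a_0, …, a_{s−1}) ∈ K^s such that f = Σ_{i=0}^{s−1} μ_{a_i} ∘ (μ_c ∘ θ)^i, i.e. f(x) = Σ_{i=0}^{s−1} a_i·(μ_c ∘ θ)^i(x) for all x ∈ K. -/
theorem RingEquiv.coe_pow_eq_iterate {R : Type*} [Mul R] [Add R] (θ : R ≃+* R) (n : ℕ) :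
    ⇑(θ ^ n : RingAut R) = (⇑θ)^[n] := by
  induction n with
  | zero => rfl
  | succ n ih => rw [pow_succ, Function.iterate_succ, ← ih]; rfl

theorem RingEquiv.orderOf_eq_of_iterate {R : Type*} [Mul R] [Add R] (θ : R ≃+* R) {s : ℕ}
    (hs : 0 < s) (hord : ∀ x : R, (⇑θ)^[s] x = x)
    (hord' : ∀ i : ℕ, 0 < i → i < s → ∃ x : R, (⇑θ)^[i] x ≠ x) :
    orderOf (θ : RingAut R) = s := by
  refine (orderOf_eq_iff hs).2 ⟨RingEquiv.ext fun x => ?_, fun i hi h0 h => ?_⟩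
  · rw [coe_pow_eq_iterate, hord]; rfl
  · obtain ⟨x, hx⟩ := hord' i h0 hi
    exact hx (by rw [← coe_pow_eq_iterate, h]; rfl)

/-- Artin's theorem for the cyclic group generated by an automorphism of finite order. -/
theorem RingEquiv.finiteDimensional_and_finrank_fixed {K : Type*} [Field K] (θ : K ≃+* K)
    (hs : 0 < orderOf (θ : RingAut K)) (F : Subfield K) (hF : ∀ x : K, x ∈ F ↔ θ x = x) :
    FiniteDimensional F K ∧ Module.finrank F K = orderOf (θ : RingAut K) := by
  let G : Subgroup (RingAut K) := Subgroup.zpowers θ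
  have hfin : Finite G := (orderOf_pos_iff.1 hs).finite_zpowers.to_subtype
  have hFG : F = FixedPoints.subfield G K := by
    ext x
    rw [hF]
    change θ x = x ↔ x ∈ MulAction.fixedPoints G K
    refine ⟨fun h g => ?_, fun h => h ⟨θ, Subgroup.mem_zpowers θ⟩⟩
    have hle : G ≤ MulAction.stabilizer (RingAut K) x :=
      (Subgroup.zpowers_le).2 (MulAction.mem_stabilizer_iff.2 h)
    exact MulAction.mem_stabilizer_iff.1 (hle g.2)
  subst hFG
  have : Fintype G := Fintype.ofFinite G
  refine ⟨inferInstance, ?_⟩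
  rw [FixedPoints.finrank_eq_card G K, ← Nat.card_eq_fintype_card, Nat.card_zpowers]

theorem RingEquiv.exists_iterate_mul_eq {K : Type*} [Field K] (θ : K ≃+* K) {c : K}
    (hc : c ≠ 0) (n : ℕ) :
    ∃ d : Kˣ, ∀ x : K, (fun y => c * θ y)^[n] x = d * (⇑θ)^[n] x := by
  induction n with
  | zero => exact ⟨1, fun x => by simp⟩
  | succ n ih =>
    obtain ⟨d, hd⟩ := ih
    refine ⟨Units.mk0 (c * θ d) (mul_ne_zero hc (by simp)), fun x => ?_⟩
    rw [Function.iterate_succ_apply', hd, Function.iterate_succ_apply']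
    simp [mul_assoc]

/-- Dedekind independence for the iterates of `μ_c ∘ θ` below the order of `θ`. -/
theorem RingEquiv.linearIndependent_iterate_mul {K : Type*} [Field K] (θ : K ≃+* K) {c : K}
    (hc : c ≠ 0) :
    LinearIndependent K (fun i : Fin (orderOf (θ : RingAut K)) =>
      (fun y => c * θ y)^[(i : ℕ)]) := by
  choose d hd using θ.exists_iterate_mul_eq hc
  have hinj : Function.Injective (fun i : Fin (orderOf (θ : RingAut K)) =>
      ((θ ^ (i : ℕ) : RingAut K) : K →* K)) := fun i j hij =>
    Fin.ext (pow_injOn_Iio_orderOf i.2 j.2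
      (RingEquiv.ext fun x => DFunLike.congr_fun hij x))
  have heq : (fun i : Fin (orderOf (θ : RingAut K)) => (fun y => c * θ y)^[(i : ℕ)]) =
      fun i : Fin _ => d i • ⇑((θ ^ (i : ℕ) : RingAut K) : K →* K) := by
    ext i x
    change _ = (d i : K) * (θ ^ (i : ℕ) : RingAut K) x
    rw [hd, coe_pow_eq_iterate]
  rw [heq]
  exact ((linearIndependent_monoidHom K K).comp _ hinj).units_smul fun i => d i

/-- If `θ` is an automorphism of a field `K` of finite order `s ≥ 2` with fixed field `F`
and `c ∈ K` is nonzero, then every `F`-linear endomorphism of `K` is uniquely of the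
form `Σ_{i<s} a_i (μ_c ∘ θ)^i`. -/
theorem surjectivity_of_evaluation_endomorphic
    (K : Type*) [Field K] (θ : K ≃+* K) (s : ℕ) (hs : 2 ≤ s)
    (hord : ∀ x : K, (⇑θ)^[s] x = x)
    (hord' : ∀ i : ℕ, 0 < i → i < s → ∃ x : K, (⇑θ)^[i] x ≠ x)
    (F : Subfield K) (hF : ∀ x : K, x ∈ F ↔ θ x = x)
    (c : K) (hc : c ≠ 0) :
    ∀ f : K →ₗ[F] K, ∃! a : Fin s → K,
      ∀ x : K, f x = ∑ i : Fin s, a i * (fun y => c * θ y)^[(i : ℕ)] x := by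
  obtain rfl := θ.orderOf_eq_of_iterate (by omega) hord hord'
  obtain ⟨hfd, hrank⟩ := θ.finiteDimensional_and_finrank_fixed (by omega) F hF
  let T : K →ₗ[F] K :=
    { toFun := fun y => c * θ y
      map_add' := fun x y => by rw [map_add, mul_add]
      map_smul' := fun r x => by
        simp only [Subfield.smul_def, smul_eq_mul, map_mul, (hF r).1 r.2, RingHom.id_apply]
        ring }
  let v : Fin (orderOf (θ : RingAut K)) → K →ₗ[F] K := fun i => T ^ (i : ℕ)
  have hv : ∀ i x, v i x = (fun y => c * θ y)^[(i : ℕ)] x := fun i x =>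
    Module.End.pow_apply T i x
  have hli : LinearIndependent K v := by
    refine LinearIndependent.of_comp (LinearMap.ltoFun F K K K) ?_
    convert θ.linearIndependent_iterate_mul hc using 1
    ext i x
    exact hv i x
  have hdim : Module.finrank K (Fin (orderOf (θ : RingAut K)) → K) =
      Module.finrank K (K →ₗ[F] K) := by
    rw [Module.finrank_fin_fun, Module.finrank_linearMap_self, hrank]
  have hbij : Function.Bijective (Fintype.linearCombination K v) := by
    have hinj := hli.fintypeLinearCombination_injective
    exact ⟨hinj, (LinearMap.injective_iff_surjective_of_finrank_eq_finrank hdim).1 hinj⟩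
  intro f
  refine (existsUnique_congr fun a => ?_).1 (hbij.existsUnique f)
  rw [eq_comm, LinearMap.ext_iff]
  simp [Fintype.linearCombination_apply, LinearMap.sum_apply, hv]
end

section
/- Let p be a prime, K a field of characteristic p, δ : K → K a nonzero derivation with constant subfield F, and assume [K:F] = p^r is finite. Then for every c ∈ K and every F-linear map f : K → K there exists a unique tuple (a_0, …, a_{p^r−1}) ∈ K^{p^r} such that f = Σ_{i=0}^{p^r−1} μ_{a_i} ∘ (δ + μ_c)^i, i.e. f(x) = Σ_{i=0}^{p^r−1} a_i·(δ + μ_c)^i(x) for all x ∈ K. -/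
/-- Wronskian criterion: if `T` satisfies a Leibniz rule with respect to `δ` and `F` consists of
the constants of `δ`, then for `F`-linearly independent `x` the columns
`(x j, T (x j), …, T^(n-1) (x j))` are linearly independent over `K`. -/
theorem eq_zero_of_sum_mul_pow_apply_eq_zero {K : Type*} [Field K] (F : Subfield K) (δ : K → K)
    (hF : ∀ x : K, δ x = 0 → x ∈ F) (hone : δ 1 = 0) (T : K →ₗ[F] K)
    (hT : ∀ a x : K, T (a * x) = a * T x + δ a * x) :
    ∀ (n : ℕ) (x : Fin n → K), LinearIndependent F x → ∀ l : Fin n → K,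
      (∀ i < n, ∑ j, l j * (T ^ i) (x j) = 0) → l = 0 := by
  intro n
  induction n with
  | zero => intro x _ l _; exact Subsingleton.elim _ _
  | succ n ih =>
    intro x hx l hl
    have hx' : LinearIndependent F fun j : Fin n => x j.succ := hx.comp _ (Fin.succ_injective n)
    by_cases h0 : l 0 = 0
    · have htail : (fun j : Fin n => l j.succ) = 0 := by
        refine ih _ hx' _ fun i hi => ?_
        simpa [Fin.sum_univ_succ, h0] using hl i (by lia)
      funext j
      refine Fin.cases h0 (fun k => congrFun htail k) j
    · exfalso
      set m : Fin (n + 1) → K := fun j => (l 0)⁻¹ * l j with hm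
      have hm0 : m 0 = 1 := inv_mul_cancel₀ h0
      have hml : ∀ i < n + 1, ∑ j, m j * (T ^ i) (x j) = 0 := by
        intro i hi
        simp only [hm, mul_assoc, ← Finset.mul_sum, hl i hi, mul_zero]
      have hδm : (fun j : Fin n => δ (m j.succ)) = 0 := by
        refine ih _ hx' _ fun i hi => ?_
        have h1 := congrArg T (hml i (by lia))
        simp only [map_sum, hT, Finset.sum_add_distrib, map_zero, ← Module.End.mul_apply,
          ← pow_succ'] at h1
        rw [hml (i + 1) (by lia), zero_add, Fin.sum_univ_succ, hm0, hone, zero_mul, zero_add] at h1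
        exact h1
      have hmF : ∀ j, m j ∈ F := fun j => hF _ <|
        Fin.cases (by rw [hm0, hone]) (fun k => congrFun hδm k) j
      have hrel : ∑ j, (⟨m j, hmF j⟩ : F) • x j = 0 := by
        simpa [Subfield.smul_def] using hml 0 (by lia)
      have h00 := congrArg Subtype.val (Fintype.linearIndependent_iff.mp hx _ hrel 0)
      exact one_ne_zero (hm0.symm.trans h00)


/-- If `δ` is a nonzero derivation of a field `K` of characteristic `p` whose field of
constants `F` satisfies `[K:F] = p^r`, then for every `c ∈ K`, every `F`-linear
endomorphism of `K` is uniquely of the form `Σ_{i<p^r} a_i (δ + μ_c)^i`. -/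
theorem surjectivity_of_evaluation_differential
    (p : ℕ) (hp : p.Prime) (K : Type*) [Field K] [CharP K p]
    (δ : K → K)
    (hadd : ∀ a b : K, δ (a + b) = δ a + δ b)
    (hleib : ∀ a b : K, δ (a * b) = a * δ b + δ a * b)
    (hδ : δ ≠ 0)
    (F : Subfield K) (hF : ∀ x : K, x ∈ F ↔ δ x = 0)
    [FiniteDimensional F K] (r : ℕ) (hrk : Module.finrank F K = p ^ r) :
    ∀ c : K, ∀ f : K →ₗ[F] K, ∃! a : Fin (p ^ r) → K,
      ∀ x : K, f x = ∑ i : Fin (p ^ r), a i * (fun y => δ y + c * y)^[(i : ℕ)] x := by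
  intro c f
  have hone : δ 1 = 0 := by simpa using hleib 1 1
  let T : K →ₗ[F] K :=
    { toFun := fun y => δ y + c * y
      map_add' := fun a b => by rw [hadd]; ring
      map_smul' := fun a b => by
        simp only [Subfield.smul_def, smul_eq_mul, RingHom.id_apply]
        rw [hleib, (hF _).mp a.2]
        ring }
  have hT : ∀ a x : K, T (a * x) = a * T x + δ a * x := fun a x => by
    change δ (a * x) + c * (a * x) = a * (δ x + c * x) + δ a * x
    rw [hleib]
    ring
  have hpow : ∀ (i : ℕ) (x : K), (fun y => δ y + c * y)^[i] x = (T ^ i) x := fun i x => by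
    rw [Module.End.pow_apply]
    rfl
  let b := Module.finBasisOfFinrankEq F K hrk
  let W : Matrix (Fin (p ^ r)) (Fin (p ^ r)) K := Matrix.of fun i j => (T ^ (i : ℕ)) (b j)
  have hW : IsUnit W := by
    rw [← Matrix.mulVec_injective_iff_isUnit, ← Matrix.coe_mulVecLin,
      injective_iff_map_eq_zero]
    intro l hl
    refine eq_zero_of_sum_mul_pow_apply_eq_zero F δ (fun x => (hF x).mpr) hone T hT _ b
      b.linearIndependent l fun i hi => ?_
    simpa [W, Matrix.mulVec, dotProduct, mul_comm] using congrFun hl ⟨i, hi⟩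
  have hiff : ∀ a : Fin (p ^ r) → K,
      (∀ x : K, f x = ∑ i : Fin (p ^ r), a i * (fun y => δ y + c * y)^[(i : ℕ)] x) ↔
        Matrix.vecMul a W = fun j => f (b j) := by
    intro a
    simp only [hpow]
    constructor
    · intro h
      funext j
      rw [h]
      rfl
    · intro h x
      have hext : f = ∑ i : Fin (p ^ r), LinearMap.mulLeft F (a i) ∘ₗ T ^ (i : ℕ) :=
        b.ext fun j => by
          simpa [W, Matrix.vecMul, dotProduct] using (congrFun h j).symm
      simpa using congrArg (fun g : K →ₗ[F] K => g x) hext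
  simp only [hiff]
  exact (Function.bijective_iff_existsUnique _).mp
    ⟨Matrix.vecMul_injective_iff_isUnit.mpr hW, Matrix.vecMul_surjective_iff_isUnit.mpr hW⟩ _
end

section
/- With K, p, δ, F, r, the z_i and υ as in the context: for every c ∈ K one has δ(υ(c)) = 0, i.e. υ(c) ∈ F. -/
/-- An additive map satisfying the Leibniz rule kills `p`-th powers in characteristic `p`. -/
theorem leibniz_pow_char_eq_zero {K : Type*} [CommRing K] (p : ℕ) [CharP K p] (δ : K → K)
    (hadd : ∀ a b : K, δ (a + b) = δ a + δ b)
    (hleib : ∀ a b : K, δ (a * b) = a * δ b + δ a * b) (x : K) :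
    δ (x ^ p) = 0 := by
  let D : Derivation ℤ K K := Derivation.mk' (AddMonoidHom.mk' δ hadd).toIntLinearMap
    fun a b => (hleib a b).trans (by simp [mul_comm])
  exact (D.leibniz_pow x p).trans (by simp)


/-- The differential norm `υ(c) = Σ_{i≤r} Σ_{j≤i} (z_i δ^{p^j-1}(c))^{p^{i-j}}` is a
constant of `δ`, i.e. it belongs to the subfield `F` of constants. -/
theorem differential_norm_mem_constants
    (p : ℕ) (hp : p.Prime) (K : Type*) [Field K] [CharP K p]
    (δ : K → K)
    (hadd : ∀ a b : K, δ (a + b) = δ a + δ b)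
    (hleib : ∀ a b : K, δ (a * b) = a * δ b + δ a * b)
    (hδ : δ ≠ 0)
    (F : Subfield K) (hF : ∀ x : K, x ∈ F ↔ δ x = 0)
    [FiniteDimensional F K] (r : ℕ) (hrk : Module.finrank F K = p ^ r)
    (z : ℕ → K) (hzF : ∀ i, i < r → δ (z i) = 0) (hzr : z r = 1)
    (hrel : ∀ x : K, δ^[p ^ r] x + ∑ i ∈ Finset.range r, z i * δ^[p ^ i] x = 0) :
    ∀ c : K,
      δ (∑ i ∈ Finset.range (r + 1), ∑ j ∈ Finset.range (i + 1),
          (z i * δ^[p ^ j - 1] c) ^ p ^ (i - j)) = 0 := by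
  intro c
  let D : K →+ K := AddMonoidHom.mk' δ hadd
  have hconst : ∀ i ∈ Finset.range (r + 1), δ (z i) = 0 := by
    intro i hi
    rcases (Finset.mem_range_succ_iff.mp hi).lt_or_eq with h | rfl
    · exact hzF i h
    · simpa [hzr] using hleib 1 1
  have hterm : ∀ i ∈ Finset.range (r + 1),
      δ (∑ j ∈ Finset.range (i + 1), (z i * δ^[p ^ j - 1] c) ^ p ^ (i - j)) =
        z i * δ^[p ^ i] c := by
    intro i hi
    refine (map_sum D _ _).trans ?_
    rw [Finset.sum_range_succ, Finset.sum_eq_zero, zero_add]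
    · change δ ((z i * δ^[p ^ i - 1] c) ^ p ^ (i - i)) = _
      rw [Nat.sub_self, pow_zero, pow_one, hleib, hconst i hi, zero_mul, add_zero,
        ← Function.iterate_succ_apply' δ, Nat.succ_eq_add_one,
        Nat.sub_add_cancel (Nat.one_le_pow _ _ hp.pos)]
    · intro j hj
      obtain ⟨k, hk⟩ := Nat.exists_eq_succ_of_ne_zero
        (Nat.sub_pos_of_lt (Finset.mem_range.mp hj)).ne'
      rw [hk, pow_succ, pow_mul]
      exact leibniz_pow_char_eq_zero p δ hadd hleib _
  refine (map_sum D _ _).trans ((Finset.sum_congr rfl hterm).trans ?_)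
  rw [Finset.sum_range_succ, hzr, one_mul, add_comm]
  exact hrel c
end

section
/- Let K, θ, δ, F be as in the context and let u : K → K be an unramified pseudo-linear endomorphism of K with respect to θ and δ. Then for all a_0, …, a_d ∈ K with a_d ≠ 0, the F-linear subspace {x ∈ K : Σ_{i=0}^{d} a_i·u^i(x) = 0} of K has dimension at most d over F. -/
namespace PseudoLinear

variable {K : Type*} [Field K]

/-- The left `K`-space of skew polynomials in `u` of degree less than `n`, viewed as functions. -/
def degreeLT (u : K → K) (n : ℕ) : Submodule K (K → K) :=
  Submodule.span K {f | ∃ j < n, f = u^[j]}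

theorem iterate_mem_degreeLT (u : K → K) {j n : ℕ} (h : j < n) : u^[j] ∈ degreeLT u n :=
  Submodule.subset_span ⟨j, h, rfl⟩

theorem degreeLT_mono (u : K → K) {m n : ℕ} (h : m ≤ n) : degreeLT u m ≤ degreeLT u n :=
  Submodule.span_mono fun _ ⟨j, hj, e⟩ => ⟨j, hj.trans_le h, e⟩

variable {θ : K →+* K} {δ u : K → K}

theorem comp_mem_degreeLT (huadd : ∀ x y : K, u (x + y) = u x + u y)
    (hups : ∀ a x : K, u (a * x) = θ a * u x + δ a * x) {n : ℕ} {f : K → K}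
    (hf : f ∈ degreeLT u n) : u ∘ f ∈ degreeLT u (n + 1) := by
  refine Submodule.span_induction (p := fun f _ => u ∘ f ∈ degreeLT u (n + 1))
    ?_ ?_ ?_ ?_ hf
  · rintro _ ⟨j, hj, rfl⟩
    rw [← Function.iterate_succ']
    exact iterate_mem_degreeLT u (by omega)
  · have h0 : u 0 = 0 := by simpa using huadd 0 0
    convert Submodule.zero_mem _
    ext y
    simp [h0]
  · intro f g _ _ hf hg
    convert Submodule.add_mem _ hf hg
    ext y
    simp [huadd]
  · intro c f hf' hf
    have : u ∘ (c • f) = θ c • (u ∘ f) + δ c • f := by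
      ext y
      simp [hups]
    rw [this]
    exact Submodule.add_mem _ (Submodule.smul_mem _ _ hf)
      (Submodule.smul_mem _ _ (degreeLT_mono u n.le_succ hf'))

/-- Right division of `u ^ (n + 1)` by `u - t`. -/
theorem exists_iterate_succ_eq (huadd : ∀ x y : K, u (x + y) = u x + u y)
    (hups : ∀ a x : K, u (a * x) = θ a * u x + δ a * x) (t : K) (n : ℕ) :
    ∃ q : K → K, ∃ r : K, q - u^[n] ∈ degreeLT u n ∧
      ∀ y, u^[n + 1] y = q (u y - t * y) + r * y := by
  induction n with
  | zero => exact ⟨id, t, by simp, fun y => by simp⟩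
  | succ n ih =>
    obtain ⟨q, r, hq, h⟩ := ih
    refine ⟨u ∘ q + θ r • id, θ r * t + δ r, ?_, fun y => ?_⟩
    · have : u ∘ q + θ r • id - u^[n + 1] = u ∘ (q - u^[n]) + θ r • u^[0] := by
        ext y
        have := huadd (q y - u^[n] y) (u^[n] y)
        rw [sub_add_cancel] at this
        simp only [Pi.sub_apply, Pi.add_apply, Function.comp_apply, Pi.smul_apply, id,
          Function.iterate_succ_apply', Function.iterate_zero, this]
        ring
      rw [this]
      exact Submodule.add_mem _ (comp_mem_degreeLT huadd hups hq)
        (Submodule.smul_mem _ _ (iterate_mem_degreeLT u n.succ_pos))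
    · rw [Function.iterate_succ_apply', h, huadd, hups]
      simp only [Pi.add_apply, Function.comp_apply, Pi.smul_apply, id, smul_eq_mul]
      ring

/-- Right division by `u - t` of a skew polynomial of degree at most `n`. -/
theorem exists_eq_of_mem_degreeLT (huadd : ∀ x y : K, u (x + y) = u x + u y)
    (hups : ∀ a x : K, u (a * x) = θ a * u x + δ a * x) (t : K) {n : ℕ} {f : K → K}
    (hf : f ∈ degreeLT u (n + 1)) :
    ∃ q ∈ degreeLT u n, ∃ r : K, ∀ y, f y = q (u y - t * y) + r * y := by
  refine Submodule.span_induction (p := fun f _ => ∃ q ∈ degreeLT u n, ∃ r : K,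
    ∀ y, f y = q (u y - t * y) + r * y) ?_ ?_ ?_ ?_ hf
  · rintro _ ⟨j, hj, rfl⟩
    cases j with
    | zero => exact ⟨0, Submodule.zero_mem _, 1, fun y => by simp⟩
    | succ k =>
      obtain ⟨q, r, hq, h⟩ := exists_iterate_succ_eq huadd hups t k
      refine ⟨q, ?_, r, h⟩
      rw [← sub_add_cancel q u^[k]]
      exact Submodule.add_mem _ (degreeLT_mono u (by omega) hq)
        (iterate_mem_degreeLT u (by omega))
  · exact ⟨0, Submodule.zero_mem _, 0, fun y => by simp⟩
  · rintro f g _ _ ⟨q, hq, r, h⟩ ⟨q', hq', r', h'⟩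
    refine ⟨q + q', Submodule.add_mem _ hq hq', r + r', fun y => ?_⟩
    simp only [Pi.add_apply, h, h']
    ring
  · rintro c f _ ⟨q, hq, r, h⟩
    refine ⟨c • q, Submodule.smul_mem _ c hq, c * r, fun y => ?_⟩
    simp only [Pi.smul_apply, smul_eq_mul, h]
    ring

/-- If `u` is unramified and `x ≠ 0`, then `u` commutes with multiplication by `a` at `x` only for
constants `a`. -/
theorem eq_and_eq_zero_of_map_mul_eq (hδleib : ∀ a b : K, δ (a * b) = θ a * δ b + δ a * b)
    (hups : ∀ a x : K, u (a * x) = θ a * u x + δ a * x)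
    (hur : ¬ ∃ lam : K, ∀ x : K, u x = lam * x) {a x : K} (hx : x ≠ 0)
    (h : u (a * x) = a * u x) : θ a = a ∧ δ a = 0 := by
  rw [hups] at h
  by_cases ha : θ a = a
  · refine ⟨ha, ?_⟩
    rw [ha] at h
    simpa [hx] using h
  · refine (hur ⟨u x / x, fun y => ?_⟩).elim
    have hcross (b : K) : (θ a - a) * δ b = (θ b - b) * δ a := by
      have h1 := hδleib a b
      rw [mul_comm, hδleib] at h1
      linear_combination -h1
    have hb (b : K) : u (b * x) = b * u x := by
      rw [hups]
      refine mul_left_cancel₀ (sub_ne_zero.2 ha) ?_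
      linear_combination (θ b - b) * h + x * hcross b
    have := hb (y / x)
    rw [div_mul_cancel₀ _ hx] at this
    rw [this]
    ring

theorem finrank_le_of_forall_eq_zero (hδleib : ∀ a b : K, δ (a * b) = θ a * δ b + δ a * b)
    {F : Subfield K} (hF : ∀ x : K, x ∈ F ↔ θ x = x ∧ δ x = 0) [FiniteDimensional F K]
    (huadd : ∀ x y : K, u (x + y) = u x + u y)
    (hups : ∀ a x : K, u (a * x) = θ a * u x + δ a * x)
    (hur : ¬ ∃ lam : K, ∀ x : K, u x = lam * x) {a : K} (ha : a ≠ 0) (d : ℕ) {f : K → K}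
    (hf : f ∈ degreeLT u d) {V : Submodule F K} (hV : ∀ y ∈ V, a * u^[d] y + f y = 0) :
    Module.finrank F V ≤ d := by
  induction d generalizing f V with
  | zero =>
    have hf0 : f = 0 := by simpa [degreeLT] using hf
    have : V = ⊥ := by
      rw [Submodule.eq_bot_iff]
      intro y hy
      simpa [hf0, ha] using hV y hy
    simp [this]
  | succ d ih =>
    by_cases hbot : V = ⊥
    · rw [hbot, finrank_bot]
      exact Nat.zero_le _
    obtain ⟨x, hxV, hx⟩ := Submodule.exists_mem_ne_zero_of_ne_bot hbot
    let t := u x / x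
    have ht : t * x = u x := div_mul_cancel₀ _ hx
    let w : K →ₗ[F] K :=
      { toFun := fun y => u y - t * y
        map_add' := fun y z => by rw [huadd]; ring
        map_smul' := fun c y => by
          obtain ⟨h1, h2⟩ := (hF c).1 c.2
          simp only [Subfield.smul_def, smul_eq_mul, hups, h1, h2, RingHom.id_apply]
          ring }
    have hw (y : K) : w y = u y - t * y := rfl
    obtain ⟨q, r, hq, hqr⟩ := exists_iterate_succ_eq huadd hups t d
    obtain ⟨p, hp, s, hps⟩ := exists_eq_of_mem_degreeLT huadd hups t hf
    have hg : a • (q - u^[d]) + p ∈ degreeLT u d :=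
      Submodule.add_mem _ (Submodule.smul_mem _ _ hq) hp
    have hsum (y : K) : a * u^[d + 1] y + f y =
        a * u^[d] (w y) + (a • (q - u^[d]) + p) (w y) + (a * r + s) * y := by
      simp only [hqr, hps, hw, Pi.add_apply, Pi.smul_apply, Pi.sub_apply, smul_eq_mul]
      ring
    have hu0 : u 0 = 0 := by simpa using huadd 0 0
    have hg0 : ∀ g ∈ degreeLT u d, g 0 = 0 := fun g hg =>
      Submodule.span_induction (p := fun g _ => g 0 = 0)
        (by rintro _ ⟨j, -, rfl⟩; exact Function.iterate_fixed hu0 j) rfl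
        (fun f g _ _ h h' => by simp [h, h']) (fun c f _ h => by simp [h]) hg
    have hrem : a * r + s = 0 := by
      have h := hV x hxV
      have hwx : w x = 0 := by rw [hw, ht, sub_self]
      rw [hsum, hwx, hg0 _ hg, Function.iterate_fixed hu0] at h
      simpa [hx] using h
    have hrange : Module.finrank F (LinearMap.range (w.domRestrict V)) ≤ d := by
      refine ih hg ?_
      rintro _ ⟨y, rfl⟩
      have h := hV y y.2
      rw [hsum, hrem, zero_mul, add_zero] at h
      exact h
    have hker : Module.finrank F (LinearMap.ker (w.domRestrict V)) ≤ 1 := by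
      refine finrank_le_one ⟨⟨x, hxV⟩, by simp [hw, ht]⟩ fun y => ?_
      have hy : u y = t * y := sub_eq_zero.1 y.2
      have hyx : (y : K) / x * x = y := div_mul_cancel₀ _ hx
      have hmem : (y : K) / x ∈ F := (hF _).2
        (eq_and_eq_zero_of_map_mul_eq hδleib hups hur hx (by rw [hyx, hy, ← ht]; field_simp))
      exact ⟨⟨_, hmem⟩, Subtype.ext (Subtype.ext hyx)⟩
    have := (w.domRestrict V).finrank_range_add_finrank_ker
    omega

end PseudoLinear

/-- Bound on the dimension of the kernel: if `u` is an unramified pseudo-linear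
endomorphism of `K`, then the solution space of `Σ_{i≤d} a_i u^i(x) = 0` (with
`a_d ≠ 0`) has dimension at most `d` over `F`. -/
theorem kernel_dim_le_degree
    (K : Type*) [Field K] (θ : K →+* K) (δ : K → K)
    (hδadd : ∀ a b : K, δ (a + b) = δ a + δ b)
    (hδleib : ∀ a b : K, δ (a * b) = θ a * δ b + δ a * b)
    (hnt : θ ≠ RingHom.id K ∨ δ ≠ 0)
    (F : Subfield K) (hF : ∀ x : K, x ∈ F ↔ θ x = x ∧ δ x = 0)
    [FiniteDimensional F K]
    (u : K → K)
    (huadd : ∀ x y : K, u (x + y) = u x + u y)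
    (hups : ∀ a x : K, u (a * x) = θ a * u x + δ a * x)
    (hur : ¬ ∃ lam : K, ∀ x : K, u x = lam * x) :
    ∀ (d : ℕ) (a : Fin (d + 1) → K), a (Fin.last d) ≠ 0 →
      ∀ V : Submodule F K,
        (V : Set K) = {x : K | ∑ i : Fin (d + 1), a i * u^[(i : ℕ)] x = 0} →
        Module.finrank F V ≤ d := by
  intro d a ha V hV
  refine PseudoLinear.finrank_le_of_forall_eq_zero hδleib hF huadd hups hur ha d
    (f := ∑ i : Fin d, a i.castSucc • u^[(i : ℕ)]) ?_ fun y hy => ?_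
  · exact Submodule.sum_mem _ fun i _ =>
      Submodule.smul_mem _ _ (PseudoLinear.iterate_mem_degreeLT u i.2)
  · have h : y ∈ (V : Set K) := hy
    rw [hV, Set.mem_ofPred_eq, Fin.sum_univ_castSucc] at h
    rw [add_comm]
    simpa using h
end

section
/- Let K, θ, δ, F be as in the context and let u : K → K be an unramified pseudo-linear endomorphism of K with respect to θ and δ. Then for every F-linear subspace V of K of dimension d over F, there exists a unique tuple (a_0, …, a_{d−1}) ∈ K^d such that {x ∈ K : u^d(x) + Σ_{i=0}^{d−1} a_i·u^i(x) = 0} = V. -/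
section PseudoLinear

variable {K : Type*} [Field K] {θ : K →+* K} {δ u : K → K}

/-- Moving a scalar to the left of an iterate of a pseudo-linear map does not raise the degree. -/
theorem exists_iterate_mul_eq_sum (huadd : ∀ x y : K, u (x + y) = u x + u y)
    (hups : ∀ a x : K, u (a * x) = θ a * u x + δ a * x) (lam : K) (n : ℕ) :
    ∃ e : ℕ → K, ∀ x : K,
      u^[n] (lam * x) = ∑ i ∈ Finset.range (n + 1), e i * u^[i] x := by
  let U : K →+ K := AddMonoidHom.mk' u huadd
  have hsum (s : Finset ℕ) (f : ℕ → K) : u (∑ i ∈ s, f i) = ∑ i ∈ s, u (f i) := map_sum U f s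
  induction n with
  | zero => exact ⟨fun _ => lam, fun x => by simp⟩
  | succ n ih =>
    obtain ⟨e, he⟩ := ih
    refine ⟨fun i => (if i = 0 then 0 else θ (e (i - 1))) + (if i = n + 1 then 0 else δ (e i)),
      fun x => ?_⟩
    rw [Function.iterate_succ_apply', he, hsum]
    simp only [hups, ← Function.iterate_succ_apply', add_mul, Finset.sum_add_distrib]
    congr 1
    · rw [Finset.sum_range_succ' _ (n + 1)]
      simp
    · rw [Finset.sum_range_succ _ (n + 1)]
      simp only [if_true, zero_mul, add_zero]
      refine Finset.sum_congr rfl fun i hi => ?_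
      rw [if_neg (Finset.mem_range.1 hi).ne]

/-- Right Euclidean division of a polynomial in `u` by `u - lam`. -/
theorem exists_right_division (huadd : ∀ x y : K, u (x + y) = u x + u y)
    (hups : ∀ a x : K, u (a * x) = θ a * u x + δ a * x) (lam : K) (n : ℕ) :
    ∀ a : ℕ → K, ∃ (b : ℕ → K) (c : K),
      (∀ x, ∑ i ∈ Finset.range (n + 1), a i * u^[i] x
        = ∑ i ∈ Finset.range n, b i * u^[i] (u x - lam * x) + c * x) ∧
      ((∀ i < n, b i = 0) → ∀ i < n, a (i + 1) = 0) := by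
  induction n with
  | zero => exact fun a => ⟨0, a 0, fun x => by simp, by simp⟩
  | succ n ih =>
    intro a
    obtain ⟨e, he⟩ := exists_iterate_mul_eq_sum huadd hups lam n
    obtain ⟨b, c, hb, hb0⟩ := ih fun i => a i + a (n + 1) * e i
    refine ⟨fun i => if i = n then a (n + 1) else b i, c, fun x => ?_, fun h => ?_⟩
    · have hsub (y z : K) : u^[n] (y - z) = u^[n] y - u^[n] z :=
        iterate_map_sub (AddMonoidHom.mk' u huadd) n y z
      have hx := hb x
      simp only [add_mul, Finset.sum_add_distrib, mul_assoc, ← Finset.mul_sum, ← he] at hx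
      have hc : ∑ i ∈ Finset.range n, (if i = n then a (n + 1) else b i) * u^[i] (u x - lam * x)
          = ∑ i ∈ Finset.range n, b i * u^[i] (u x - lam * x) :=
        Finset.sum_congr rfl fun i hi => by rw [if_neg (Finset.mem_range.1 hi).ne]
      rw [Finset.sum_range_succ, Finset.sum_range_succ (n := n)
        (f := fun i => (if i = n then a (n + 1) else b i) * u^[i] (u x - lam * x)), hc, if_pos rfl, hsub,
        Function.iterate_succ_apply]
      linear_combination hx
    · have ha : a (n + 1) = 0 := by simpa using h n n.lt_succ_self
      intro i hi
      rcases (Nat.lt_succ_iff.1 hi).eq_or_lt with rfl | hin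
      · exact ha
      · simpa [ha] using hb0 (fun j hj => by simpa [hj.ne] using h j (hj.trans n.lt_succ_self)) i hin

/-- The eigenspaces of an unramified pseudo-linear endomorphism of `K` are lines over the field
of constants. -/
theorem exists_mem_mul_eq_of_eigenvectors
    (hδleib : ∀ a b : K, δ (a * b) = θ a * δ b + δ a * b)
    {F : Subfield K} (hF : ∀ x : K, x ∈ F ↔ θ x = x ∧ δ x = 0)
    (hups : ∀ a x : K, u (a * x) = θ a * u x + δ a * x)
    (hur : ¬ ∃ lam : K, ∀ x : K, u x = lam * x)
    {lam x y : K} (hx : x ≠ 0) (hux : u x = lam * x) (huy : u y = lam * y) :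
    ∃ c ∈ F, c * x = y := by
  have hy : y / x * x = y := div_mul_cancel₀ y hx
  refine ⟨y / x, ?_, hy⟩
  set c := y / x
  have hδc : δ c = -lam * (θ c - c) := by
    have h := hups c x
    rw [hy, huy, hux, ← hy] at h
    exact mul_right_cancel₀ hx (by linear_combination -h)
  by_cases hc : θ c - c = 0
  · exact (hF c).2 ⟨sub_eq_zero.1 hc, by rw [hδc, hc, mul_zero]⟩
  refine (hur ⟨lam, fun z => ?_⟩).elim
  have hδ (b : K) : δ b = -lam * (θ b - b) := by
    have h := hδleib b c
    rw [mul_comm b c, hδleib c b] at h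
    exact mul_left_cancel₀ hc (by linear_combination h + (θ b - b) * hδc)
  have h := hups (z / x) x
  rw [div_mul_cancel₀ z hx, hux, hδ] at h
  rw [h]
  linear_combination lam * div_mul_cancel₀ z hx

/-- A polynomial in `u` with `n` coefficients that kills a subspace of dimension at least `n` has
only zero coefficients. -/
theorem coeff_eq_zero_of_forall_mem_sum_eq_zero
    (hδleib : ∀ a b : K, δ (a * b) = θ a * δ b + δ a * b)
    {F : Subfield K} (hF : ∀ x : K, x ∈ F ↔ θ x = x ∧ δ x = 0) [FiniteDimensional F K]
    (huadd : ∀ x y : K, u (x + y) = u x + u y)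
    (hups : ∀ a x : K, u (a * x) = θ a * u x + δ a * x)
    (hur : ¬ ∃ lam : K, ∀ x : K, u x = lam * x) (n : ℕ) :
    ∀ (V : Submodule F K) (a : ℕ → K), n ≤ Module.finrank F V →
      (∀ x ∈ V, ∑ i ∈ Finset.range n, a i * u^[i] x = 0) → ∀ i < n, a i = 0 := by
  induction n with
  | zero => simp
  | succ n ih =>
    intro V a hV ha
    obtain ⟨y, hyV, hy⟩ : ∃ y ∈ V, y ≠ 0 := by
      refine V.ne_bot_iff.1 ?_
      rintro rfl
      simp at hV
    set lam := u y / y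
    have huy : u y = lam * y := (div_mul_cancel₀ _ hy).symm
    obtain ⟨b, c, hb, hb0⟩ := exists_right_division huadd hups lam n a
    have hu0 (i : ℕ) : u^[i] 0 = 0 := iterate_map_zero (AddMonoidHom.mk' u huadd) i
    have hc : c = 0 := by
      have h := hb y
      rw [ha y hyV, huy, sub_self] at h
      simpa [hu0, hy] using h.symm
    let L : K →ₗ[F] K :=
      { toFun := fun x => u x - lam * x
        map_add' := fun x z => by rw [huadd]; ring
        map_smul' := fun f x => by
          obtain ⟨h1, h2⟩ := (hF f).1 f.2
          simp only [Subfield.smul_def, smul_eq_mul, hups, h1, h2, RingHom.id_apply]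
          ring }
    have hker : Module.finrank F (L.domRestrict V).ker ≤ 1 := by
      refine finrank_le_one
        (⟨⟨y, hyV⟩, show u y - lam * y = 0 by rw [huy, sub_self]⟩ : (L.domRestrict V).ker) ?_
      rintro ⟨⟨z, hzV⟩, hz⟩
      have hz' : u z - lam * z = 0 := hz
      obtain ⟨f, hf, hfz⟩ := exists_mem_mul_eq_of_eigenvectors hδleib hF hups hur hy huy
        (sub_eq_zero.1 hz')
      exact ⟨⟨f, hf⟩, Subtype.ext (Subtype.ext hfz)⟩
    have hrank := (L.domRestrict V).finrank_range_add_finrank_ker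
    have hb_zero := ih (L.domRestrict V).range b (by omega) (by
      rintro _ ⟨⟨x, hxV⟩, rfl⟩
      have h := hb x
      rw [ha x hxV, hc, zero_mul, add_zero] at h
      exact h.symm)
    have ha_succ := hb0 hb_zero
    have ha_zero : a 0 = 0 := by
      have h := ha y hyV
      rw [Finset.sum_range_succ', Finset.sum_eq_zero fun i hi => by
        rw [ha_succ i (Finset.mem_range.1 hi), zero_mul]] at h
      simpa [hy] using h
    rintro (_ | i) hi
    · exact ha_zero
    · exact ha_succ i (by omega)

end PseudoLinear


/-- Vanishing polynomial of a subspace: if `u` is an unramified pseudo-linear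
endomorphism of `K`, then for every `F`-subspace `V` of `K` of dimension `d` there is
a unique tuple `(a_0, …, a_{d-1})` such that `V` is exactly the solution space of
`u^d(x) + Σ_{i<d} a_i u^i(x) = 0`. -/
theorem vanishing_polynomial_exists_unique
    (K : Type*) [Field K] (θ : K →+* K) (δ : K → K)
    (hδadd : ∀ a b : K, δ (a + b) = δ a + δ b)
    (hδleib : ∀ a b : K, δ (a * b) = θ a * δ b + δ a * b)
    (hnt : θ ≠ RingHom.id K ∨ δ ≠ 0)
    (F : Subfield K) (hF : ∀ x : K, x ∈ F ↔ θ x = x ∧ δ x = 0)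
    [FiniteDimensional F K]
    (u : K → K)
    (huadd : ∀ x y : K, u (x + y) = u x + u y)
    (hups : ∀ a x : K, u (a * x) = θ a * u x + δ a * x)
    (hur : ¬ ∃ lam : K, ∀ x : K, u x = lam * x) :
    ∀ (V : Submodule F K) (d : ℕ), Module.finrank F V = d →
      ∃! a : Fin d → K,
        {x : K | u^[d] x + ∑ i : Fin d, a i * u^[(i : ℕ)] x = 0} = (V : Set K) := by
  intro V d hd
  have key := coeff_eq_zero_of_forall_mem_sum_eq_zero hδleib hF huadd hups hur
  have hker (a : Fin d → K) (ha : ∀ x ∈ V, ∑ i : Fin d, a i * u^[(i : ℕ)] x = 0) : a = 0 := by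
    have h := key d V (fun i => if h : i < d then a ⟨i, h⟩ else 0) hd.ge fun x hx => by
      rw [Finset.sum_range, ← ha x hx]
      simp
    ext i
    simpa using h i i.2
  let iter (i : ℕ) : K →ₗ[F] K :=
    { toFun := u^[i]
      map_add' := iterate_map_add (AddMonoidHom.mk' u huadd) i
      map_smul' := fun f x => by
        obtain ⟨h1, h2⟩ := (hF f).1 f.2
        have hcomm : Function.Commute u (fun x => (f : K) * x) := fun x => by
          rw [hups, h1, h2, zero_mul, add_zero]
        exact hcomm.iterate_left i x }
  let op (a : Fin d → K) : K →ₗ[F] K := ∑ i, (LinearMap.mulLeft F (a i)) ∘ₗ iter i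
  have hop (a : Fin d → K) (x : K) : op a x = ∑ i : Fin d, a i * u^[(i : ℕ)] x := by
    simp only [op, LinearMap.sum_apply]
    rfl
  let B := Module.finBasisOfFinrankEq F V hd
  have ext_basis (f : K →ₗ[F] K) (hf : ∀ j, f (B j) = 0) (x : K) (hx : x ∈ V) : f x = 0 := by
    have h : f ∘ₗ V.subtype = 0 := B.ext hf
    exact LinearMap.congr_fun h ⟨x, hx⟩
  let M : (Fin d → K) →ₗ[K] (Fin d → K) :=
    { toFun := fun a j => ∑ i : Fin d, a i * u^[(i : ℕ)] (B j)
      map_add' := fun a b => by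
        ext j
        simp [add_mul, Finset.sum_add_distrib]
      map_smul' := fun c a => by
        ext j
        simp [mul_assoc, Finset.mul_sum] }
  have hM : Function.Injective M := by
    refine (injective_iff_map_eq_zero M).2 fun a ha => hker a fun x hx => ?_
    rw [← hop]
    exact ext_basis (op a) (fun j => (hop a _).trans (congrFun ha j)) x hx
  obtain ⟨a, ha⟩ := LinearMap.injective_iff_surjective.1 hM fun j => -u^[d] (B j)
  let D : K →ₗ[F] K := iter d + op a
  have hD (x : K) : D x = u^[d] x + ∑ i : Fin d, a i * u^[(i : ℕ)] x :=
    congrArg (u^[d] x + ·) (hop a x)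
  have hVD : V ≤ D.ker := fun x hx => ext_basis D (fun j => by
    rw [hD, show ∑ i : Fin d, a i * u^[(i : ℕ)] (B j) = -u^[d] (B j) from congrFun ha j,
      add_neg_cancel]) x hx
  have hDrank : Module.finrank F D.ker ≤ d := by
    by_contra! hlt
    have h := key (d + 1) D.ker (fun i => if h : i < d then a ⟨i, h⟩ else 1) hlt (fun x hx => by
      rw [Finset.sum_range_succ, Finset.sum_range, ← LinearMap.mem_ker.1 hx, hD]
      simp [add_comm]) d d.lt_succ_self
    simp at h
  have hVeq : V = D.ker := Submodule.eq_of_le_of_finrank_le hVD (hDrank.trans hd.ge)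
  refine ⟨a, ?_, fun b hb => ?_⟩
  · ext x
    rw [Set.mem_ofPred_eq, ← hD, SetLike.mem_coe, hVeq, LinearMap.mem_ker]
  · refine sub_eq_zero.1 (hker (b - a) fun x hx => ?_)
    have hbx : u^[d] x + ∑ i : Fin d, b i * u^[(i : ℕ)] x = 0 := hb.ge hx
    have hax := (hD x).symm.trans (LinearMap.mem_ker.1 (hVD hx))
    simp only [Pi.sub_apply, sub_mul, Finset.sum_sub_distrib]
    linear_combination hbx - hax
end

section
/- Let K, θ, s, F, N be as in the context. Let c_1, …, c_m be nonzero elements of K such that the norms N(c_1), …, N(c_m) are pairwise distinct. Then for all a_0, …, a_d ∈ K with a_d ≠ 0, one has Σ_{j=1}^{m} dim_F {x ∈ K : Σ_{i=0}^{d} a_i·(μ_{c_j} ∘ θ)^i(x) = 0} ≤ d. -/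
open Finset Module

/-- The `F`-linear endomorphism `x ↦ c * θ x` of `K`, where `θ` fixes `F` pointwise. -/
def skewMap {K : Type*} [Field K] (θ : K ≃+* K) (F : Subfield K) (hF : ∀ x ∈ F, θ x = x)
    (c : K) : End F K where
  toFun x := c * θ x
  map_add' x y := by rw [map_add, mul_add]
  map_smul' r x := by
    simp only [Subfield.smul_def, smul_eq_mul, map_mul, hF r r.2, RingHom.id_apply]
    ring

section SkewEvaluation

variable {K : Type*} [Field K] {θ : K ≃+* K} {F : Subfield K} (hF : ∀ x ∈ F, θ x = x)

@[simp]
lemma skewMap_apply (c x : K) : skewMap θ F hF c x = c * θ x := rfl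

lemma skewMap_pow_mul (c : K) (n : ℕ) (e x : K) :
    (skewMap θ F hF c ^ n) (e * x) = θ^[n] e * (skewMap θ F hF c ^ n) x := by
  induction n with
  | zero => simp
  | succ n ih =>
    rw [pow_succ', End.mul_apply, ih, End.mul_apply, Function.iterate_succ_apply']
    simp only [skewMap_apply, map_mul]
    ring

/-- The value at `skewMap c` of the skew polynomial `∑ i < n, a i X ^ i`. -/
def skewEval (c : K) (n : ℕ) (a : ℕ → K) : End F K :=
  ∑ i ∈ range n, LinearMap.mulLeft F (a i) * skewMap θ F hF c ^ i

lemma skewEval_apply (c : K) (n : ℕ) (a : ℕ → K) (x : K) :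
    skewEval hF c n a x = ∑ i ∈ range n, a i * (skewMap θ F hF c ^ i) x := by
  simp [skewEval, LinearMap.sum_apply]

lemma skewEval_succ_apply (c : K) (n : ℕ) (a : ℕ → K) (x : K) :
    skewEval hF c (n + 1) a x = skewEval hF c n a x + a n * (skewMap θ F hF c ^ n) x := by
  simp only [skewEval_apply, sum_range_succ]

lemma skewEval_congr (c : K) (n : ℕ) {a b : ℕ → K} (h : ∀ i < n, a i = b i) :
    skewEval hF c n a = skewEval hF c n b :=
  sum_congr rfl fun i hi => by rw [h i (mem_range.mp hi)]

/-- Right division of a skew polynomial by `X - e`. -/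
lemma exists_skewEval_eq_add (e : K) (n : ℕ) (a : ℕ → K) (t : K) :
    ∃ (b : ℕ → K) (r : K), ∀ c x : K,
      skewEval hF c n a x + t * (skewMap θ F hF c ^ n) x =
        skewEval hF c n b (skewMap θ F hF c x - e * x) + r * x := by
  induction n generalizing t with
  | zero => exact ⟨0, t, fun c x => by simp [skewEval_apply]⟩
  | succ n ih =>
    obtain ⟨b, r, h⟩ := ih (a n + t * θ^[n] e)
    refine ⟨Function.update b n t, r, fun c x => ?_⟩
    rw [skewEval_succ_apply, skewEval_succ_apply,
      skewEval_congr hF c n (a := Function.update b n t) (b := b)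
        fun i hi => Function.update_of_ne hi.ne _ _,
      Function.update_self, map_sub (skewMap θ F hF c ^ n), skewMap_pow_mul, pow_succ,
      End.mul_apply]
    linear_combination h c x

/-- As `exists_skewEval_eq_add`, recording the leading coefficient of the quotient. -/
lemma exists_skewEval_succ_eq_add (e : K) (n : ℕ) (a : ℕ → K) :
    ∃ (b : ℕ → K) (r : K), b n = a (n + 1) ∧ ∀ c x : K,
      skewEval hF c (n + 2) a x =
        skewEval hF c (n + 1) b (skewMap θ F hF c x - e * x) + r * x := by
  obtain ⟨b, r, h⟩ := exists_skewEval_eq_add hF e n a (a n + a (n + 1) * θ^[n] e)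
  refine ⟨Function.update b n (a (n + 1)), r, Function.update_self .., fun c x => ?_⟩
  rw [skewEval_succ_apply, skewEval_succ_apply, skewEval_succ_apply,
    skewEval_congr hF c n (a := Function.update b n (a (n + 1))) (b := b)
      fun i hi => Function.update_of_ne hi.ne _ _,
    Function.update_self, map_sub (skewMap θ F hF c ^ n), skewMap_pow_mul, pow_succ,
    End.mul_apply]
  linear_combination h c x

end SkewEvaluation

lemma prod_iterate_map_eq {K : Type*} [Field K] (θ : K ≃+* K) (s : ℕ)
    (hs : ∀ x, θ^[s] x = x) {x : K} (hx : x ≠ 0) :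
    ∏ i ∈ range s, θ^[i] (θ x) = ∏ i ∈ range s, θ^[i] x := by
  have h := prod_range_succ (fun i => θ^[i] x) s
  rw [prod_range_succ', hs] at h
  exact mul_right_cancel₀ hx h

/-- If `c * θ x * y = c' * θ y * x` with `x`, `y` nonzero, then `c` and `c'` have the same norm. -/
lemma prod_iterate_eq_of_mul_eq {K : Type*} [Field K] (θ : K ≃+* K) (s : ℕ)
    (hs : ∀ x, θ^[s] x = x) {c c' x y : K} (hx : x ≠ 0) (hy : y ≠ 0)
    (h : c * θ x * y = c' * θ y * x) :
    ∏ i ∈ range s, θ^[i] c = ∏ i ∈ range s, θ^[i] c' := by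
  have hne : ∀ z : K, z ≠ 0 → ∏ i ∈ range s, θ^[i] z ≠ 0 := fun z hz =>
    prod_ne_zero_iff.mpr fun i _ h0 => hz <| θ.injective.iterate i <| by
      rw [h0, iterate_map_zero]
  have h' := congrArg (fun z => ∏ i ∈ range s, θ^[i] z) h
  simp only [iterate_map_mul, prod_mul_distrib, prod_iterate_map_eq θ s hs hx,
    prod_iterate_map_eq θ s hs hy] at h'
  refine mul_right_cancel₀ (mul_ne_zero (hne x hx) (hne y hy)) ?_
  linear_combination h'

lemma LinearMap.finrank_ker_comp_le {F V W U : Type*} [Field F] [AddCommGroup V] [Module F V]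
    [AddCommGroup W] [Module F W] [AddCommGroup U] [Module F U] [FiniteDimensional F V]
    [FiniteDimensional F W] (g : W →ₗ[F] U) (f : V →ₗ[F] W) :
    finrank F (ker (g ∘ₗ f)) ≤ finrank F (ker g) + finrank F (ker f) := by
  set h := f.domRestrict (ker (g ∘ₗ f))
  rw [← h.finrank_range_add_finrank_ker]
  refine add_le_add (Submodule.finrank_mono ?_) ?_
  · rintro _ ⟨x, rfl⟩
    exact x.2
  · refine LinearMap.finrank_le_finrank_of_injective
      (f := ((ker (g ∘ₗ f)).subtype ∘ₗ (ker h).subtype).codRestrict (ker f) fun x => x.2) ?_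
    intro x y hxy
    have hval : (x : V) = y := congrArg (fun z : ker f => (z : V)) hxy
    exact Subtype.ext (Subtype.ext hval)

theorem sum_finrank_ker_skewEval_le {K ι : Type*} [Field K] [Fintype ι] {θ : K ≃+* K} {s : ℕ}
    (hs : ∀ x, θ^[s] x = x) {F : Subfield K} (hF : ∀ x ∈ F, θ x = x)
    (hF' : ∀ x, θ x = x → x ∈ F) [FiniteDimensional F K] {c : ι → K} (hc : ∀ j, c j ≠ 0)
    (hN : Function.Injective fun j => ∏ i ∈ range s, θ^[i] (c j)) (d : ℕ) (a : ℕ → K)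
    (ha : a d ≠ 0) :
    ∑ j, finrank F (LinearMap.ker (skewEval hF (c j) (d + 1) a)) ≤ d := by
  classical
  induction d generalizing a with
  | zero =>
    refine (sum_eq_zero fun j _ => ?_).le
    rw [Submodule.finrank_eq_zero, LinearMap.ker_eq_bot']
    intro x hx
    simpa [skewEval_apply, ha] using hx
  | succ d ih =>
    by_cases h0 : ∀ j, LinearMap.ker (skewEval hF (c j) (d + 2) a) = ⊥
    · exact (sum_eq_zero fun j _ => by rw [h0 j, finrank_bot]).le.trans (Nat.zero_le _)
    push Not at h0
    obtain ⟨k, hk⟩ := h0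
    obtain ⟨y, hy, hy0⟩ := Submodule.exists_mem_ne_zero_of_ne_bot hk
    set e := c k * θ y / y with he
    obtain ⟨b, r, hb, hdiv⟩ := exists_skewEval_succ_eq_add hF e d a
    have hr : r = 0 := by
      have h := hdiv (c k) y
      rw [LinearMap.mem_ker.mp hy, skewMap_apply, he, div_mul_cancel₀ _ hy0, sub_self, map_zero,
        zero_add] at h
      exact (mul_eq_zero.mp h.symm).resolve_right hy0
    have hcomp : ∀ j, skewEval hF (c j) (d + 2) a =
        skewEval hF (c j) (d + 1) b ∘ₗ (skewMap θ F hF (c j) - LinearMap.mulLeft F e) :=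
      fun j => LinearMap.ext fun x => by simpa [hr] using hdiv (c j) x
    have hker : ∀ j x, x ∈ LinearMap.ker (skewMap θ F hF (c j) - LinearMap.mulLeft F e) →
        c j * θ x * y = c k * θ y * x := fun j x hx => by
      have h : c j * θ x - e * x = 0 := hx
      rw [sub_eq_zero.mp h, he]
      field_simp
    have hdim : ∀ j, finrank F (LinearMap.ker (skewMap θ F hF (c j) - LinearMap.mulLeft F e)) ≤
        if j = k then 1 else 0 := by
      intro j
      split_ifs with hjk
      · subst hjk
        refine (Submodule.finrank_mono (t := Submodule.span F {y}) fun x hx => ?_).trans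
          (finrank_span_singleton hy0).le
        have h := hker j x hx
        have hfix : θ (x / y) = x / y := by
          have hy1 : θ y ≠ 0 := (map_ne_zero θ).mpr hy0
          rw [map_div₀, div_eq_div_iff hy1 hy0]
          refine mul_left_cancel₀ (hc j) ?_
          linear_combination h
        refine Submodule.mem_span_singleton.mpr ⟨⟨x / y, hF' _ hfix⟩, ?_⟩
        exact div_mul_cancel₀ x hy0
      · rw [Nat.le_zero, Submodule.finrank_eq_zero, Submodule.eq_bot_iff]
        intro x hx
        by_contra hx0
        exact hjk (hN (prod_iterate_eq_of_mul_eq θ s hs hx0 hy0 (hker j x hx)))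
    calc ∑ j, finrank F (LinearMap.ker (skewEval hF (c j) (d + 2) a))
        ≤ ∑ j, (finrank F (LinearMap.ker (skewEval hF (c j) (d + 1) b)) +
            if j = k then 1 else 0) := sum_le_sum fun j _ => by
          rw [hcomp j]
          exact (LinearMap.finrank_ker_comp_le _ _).trans (Nat.add_le_add_left (hdim j) _)
      _ ≤ d + 1 := by
          rw [sum_add_distrib, sum_ite_eq' univ k, if_pos (mem_univ k)]
          exact Nat.add_le_add_right (ih b (hb ▸ ha)) 1

/-- Multiple-evaluation bound, endomorphic case: if `c_1, …, c_m` are nonzero elements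
of `K` with pairwise distinct norms, then the sum over `j` of the `F`-dimensions of the
solution spaces of `Σ_{i≤d} a_i (μ_{c_j} ∘ θ)^i(x) = 0` is at most `d`. -/
theorem multiple_evaluation_bound_endomorphic
    (K : Type*) [Field K] (θ : K ≃+* K) (s : ℕ) (hs : 2 ≤ s)
    (hord : ∀ x : K, (⇑θ)^[s] x = x)
    (hord' : ∀ i : ℕ, 0 < i → i < s → ∃ x : K, (⇑θ)^[i] x ≠ x)
    (F : Subfield K) (hF : ∀ x : K, x ∈ F ↔ θ x = x)
    [FiniteDimensional F K]
    (m : ℕ) (c : Fin m → K) (hc : ∀ j, c j ≠ 0)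
    (hN : ∀ j j' : Fin m, j ≠ j' →
      (∏ i ∈ Finset.range s, (⇑θ)^[i] (c j)) ≠ (∏ i ∈ Finset.range s, (⇑θ)^[i] (c j'))) :
    ∀ (d : ℕ) (a : Fin (d + 1) → K), a (Fin.last d) ≠ 0 →
      ∀ V : Fin m → Submodule F K,
        (∀ j, (V j : Set K) =
          {x : K | ∑ i : Fin (d + 1), a i * (fun y => c j * θ y)^[(i : ℕ)] x = 0}) →
        ∑ j : Fin m, Module.finrank F (V j) ≤ d := by
  intro d a ha V hV
  have hF₁ : ∀ x ∈ F, θ x = x := fun x => (hF x).mp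
  let a' : ℕ → K := fun i => if h : i < d + 1 then a ⟨i, h⟩ else 0
  have ha' : ∀ i : Fin (d + 1), a' i = a i := fun i => dif_pos i.2
  have hVker : ∀ j, V j = LinearMap.ker (skewEval hF₁ (c j) (d + 1) a') := fun j => by
    refine SetLike.coe_injective ((hV j).trans (Set.ext fun x => ?_))
    rw [Set.mem_ofPred_eq, SetLike.mem_coe, LinearMap.mem_ker, skewEval_apply,
      ← Fin.sum_univ_eq_sum_range (fun i => a' i * (skewMap θ F hF₁ (c j) ^ i) x)]
    simp only [ha', Module.End.pow_apply]
    rfl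
  obtain rfl := funext hVker
  refine sum_finrank_ker_skewEval_le hord hF₁ (fun x => (hF x).mpr) hc
    (fun j j' h => by_contra fun hne => hN j j' hne h) d a' ?_
  exact (ha' (Fin.last d)).trans_ne ha
end

section
/- Let K, θ, s, F, N be as in the context. Let c_1, …, c_m be nonzero elements of K with N(c_1), …, N(c_m) pairwise distinct, let V_1, …, V_m be F-linear subspaces of K and set n = Σ_{j=1}^{m} dim_F V_j. Then there exists a unique tuple (a_0, …, a_{n−1}) ∈ K^n such that for every j ∈ {1,…,m} and every x ∈ V_j one has (μ_{c_j} ∘ θ)^n(x) + Σ_{i=0}^{n−1} a_i·(μ_{c_j} ∘ θ)^i(x) = 0. -/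
/-- If `c' u = c θ(u)` with `u ≠ 0` and `θ^s = 1`, then `c` and `c'` have the same norm. -/
theorem norm_eq_of_mul_eq_mul_map {K : Type*} [Field K] (θ : K ≃+* K) (s : ℕ)
    (hord : ∀ x : K, (⇑θ)^[s] x = x) {c c' u : K} (hu : u ≠ 0) (h : c' * u = c * θ u) :
    ∏ i ∈ Finset.range s, (⇑θ)^[i] c' = ∏ i ∈ Finset.range s, (⇑θ)^[i] c := by
  have hne : ∀ i, (⇑θ)^[i] u ≠ 0 := by
    intro i
    rw [← RingEquiv.coe_toRingHom, ← RingHom.coe_pow]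
    exact (map_ne_zero _).2 hu
  have hterm : ∀ i, (⇑θ)^[i] c' * (⇑θ)^[i] u = (⇑θ)^[i] c * (⇑θ)^[i + 1] u := by
    intro i
    have hi := congrArg ((⇑θ)^[i]) h
    rw [Function.iterate_succ_apply]
    rwa [← RingEquiv.coe_toRingHom, ← RingHom.coe_pow, map_mul, map_mul, RingHom.coe_pow,
      RingEquiv.coe_toRingHom] at hi
  have hshift : ∏ i ∈ Finset.range s, (⇑θ)^[i + 1] u = ∏ i ∈ Finset.range s, (⇑θ)^[i] u := by
    have h1 := Finset.prod_range_succ (fun i => (⇑θ)^[i] u) s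
    rw [Finset.prod_range_succ', hord] at h1
    exact mul_right_cancel₀ hu h1
  have hprod : ∏ i ∈ Finset.range s, ((⇑θ)^[i] c' * (⇑θ)^[i] u) =
      ∏ i ∈ Finset.range s, ((⇑θ)^[i] c * (⇑θ)^[i + 1] u) :=
    Finset.prod_congr rfl fun i _ => hterm i
  rw [Finset.prod_mul_distrib, Finset.prod_mul_distrib, hshift] at hprod
  exact mul_right_cancel₀ (Finset.prod_ne_zero_iff.2 fun i _ => hne i) hprod

section

variable {K : Type*} [Field K] {θ : K ≃+* K} {F : Subfield K}
  {ι : Type*} {c : ι → K} {T : ι → Module.End F K}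

theorem semilinear_pow_mul (hT : ∀ j y, T j y = c j * θ y) (j : ι) (b y : K) (i : ℕ) :
    (T j ^ i) (b * y) = (⇑θ)^[i] b * (T j ^ i) y := by
  induction i with
  | zero => simp
  | succ i ih =>
    rw [pow_succ', Module.End.mul_apply, ih, hT, map_mul, Module.End.mul_apply, hT,
      Function.iterate_succ_apply']
    ring

/-- Right division of a skew polynomial by `X - b`, in evaluated form. -/
theorem exists_skew_div (hT : ∀ j y, T j y = c j * θ y) (b : K) (d : ℕ) (a : ℕ → K) :
    ∃ (q : ℕ → K) (r : K), q d = a (d + 1) ∧ ∀ j y,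
      ∑ i ∈ Finset.range (d + 2), a i * (T j ^ i) y =
        ∑ i ∈ Finset.range (d + 1), q i * (T j ^ i) (T j y - b * y) + r * y := by
  induction d generalizing a with
  | zero =>
    refine ⟨fun _ => a 1, a 0 + a 1 * b, rfl, fun j y => ?_⟩
    simp [Finset.sum_range_succ]
    ring
  | succ d ih =>
    obtain ⟨q, r, -, h⟩ := ih
      (Function.update a (d + 1) (a (d + 1) + a (d + 2) * (⇑θ)^[d + 1] b))
    refine ⟨Function.update q (d + 1) (a (d + 2)), r, by simp, fun j y => ?_⟩
    have h1 : ∑ i ∈ Finset.range (d + 1), Function.update q (d + 1) (a (d + 2)) i *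
        (T j ^ i) (T j y - b * y) =
        ∑ i ∈ Finset.range (d + 1), q i * (T j ^ i) (T j y - b * y) := by
      refine Finset.sum_congr rfl fun i hi => ?_
      rw [Function.update_of_ne (Finset.mem_range.1 hi).ne]
    have h2 : ∑ i ∈ Finset.range (d + 1), Function.update a (d + 1)
        (a (d + 1) + a (d + 2) * (⇑θ)^[d + 1] b) i * (T j ^ i) y =
        ∑ i ∈ Finset.range (d + 1), a i * (T j ^ i) y := by
      refine Finset.sum_congr rfl fun i hi => ?_
      rw [Function.update_of_ne (Finset.mem_range.1 hi).ne]
    have h3 := h j y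
    rw [Finset.sum_range_succ, h2, Function.update_self] at h3
    rw [Finset.sum_range_succ _ (d + 1), h1, Function.update_self, map_sub,
      semilinear_pow_mul hT, Finset.sum_range_succ _ (d + 2), Finset.sum_range_succ _ (d + 1)]
    have h4 : (T j ^ (d + 1)) (T j y) = (T j ^ (d + 2)) y := by
      rw [pow_succ _ (d + 1), Module.End.mul_apply]
    rw [h4]
    linear_combination h3

variable [Fintype ι] [FiniteDimensional F K]

/-- A skew polynomial of degree `d` vanishes on subspaces of total dimension at most `d`. -/
theorem sum_finrank_le_of_skew_vanishing (hT : ∀ j y, T j y = c j * θ y) (hc : ∀ j, c j ≠ 0)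
    (hF : ∀ x : K, x ∈ F ↔ θ x = x)
    (hinj : ∀ j j' u, u ≠ 0 → c j' * u = c j * θ u → j = j')
    (d : ℕ) (a : ℕ → K) (ha : a d ≠ 0) (V : ι → Submodule F K)
    (hV : ∀ j, ∀ x ∈ V j, ∑ i ∈ Finset.range (d + 1), a i * (T j ^ i) x = 0) :
    ∑ j, Module.finrank F (V j) ≤ d := by
  classical
  induction d generalizing a V with
  | zero =>
    have hbot : ∀ j, V j = ⊥ := fun j => (Submodule.eq_bot_iff _).2 fun x hx => by
      simpa [ha] using hV j x hx
    exact (Finset.sum_eq_zero fun j _ => Submodule.finrank_eq_zero.2 (hbot j)).trans_le (Nat.zero_le _)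
  | succ d ih =>
    by_cases hbot : ∀ j, V j = ⊥
    · exact (Finset.sum_eq_zero fun j _ => Submodule.finrank_eq_zero.2 (hbot j)).trans_le (Nat.zero_le _)
    push Not at hbot
    obtain ⟨j₀, hj₀⟩ := hbot
    obtain ⟨x₀, hx₀, hne⟩ := (Submodule.ne_bot_iff _).1 hj₀
    set b := T j₀ x₀ / x₀ with hb
    have hbx : T j₀ x₀ = b * x₀ := by rw [hb, div_mul_cancel₀ _ hne]
    obtain ⟨q, r, hq, hdiv⟩ := exists_skew_div hT b d a
    have hr : r = 0 := by
      have h := hdiv j₀ x₀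
      rw [hV j₀ x₀ hx₀, hbx, sub_self] at h
      simpa [hne] using h.symm
    let S : ι → Module.End F K := fun j => T j - LinearMap.mulLeft F b
    have hS : ∀ j y, S j y = T j y - b * y := fun j y => rfl
    have hle := ih q (hq ▸ ha) (fun j => (V j).map (S j)) (by
      rintro j _ ⟨x, hx, rfl⟩
      have h := hdiv j x
      rw [hV j x hx, hr, zero_mul, add_zero] at h
      rw [hS, ← h])
    have hker : ∀ j y, y ≠ 0 → S j y = 0 → j = j₀ ∧ ∃ t : F, t • x₀ = y := by
      intro j y hy h
      have hθx : θ x₀ ≠ 0 := by simpa using hne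
      have hθy : θ y ≠ 0 := by simpa using hy
      have h1 : c j * θ y * x₀ = c j₀ * θ x₀ * y := by
        rw [hS, sub_eq_zero, hT] at h
        rw [hT] at hbx
        rw [h, hbx]
        ring
      have hj : j = j₀ := by
        refine hinj j j₀ (y / x₀) (div_ne_zero hy hne) ?_
        rw [map_div₀]
        field_simp
        linear_combination -h1
      refine ⟨hj, ⟨y / x₀, (hF _).2 ?_⟩, ?_⟩
      · subst hj
        rw [map_div₀, div_eq_div_iff hθx hne]
        apply mul_left_cancel₀ (hc j)
        linear_combination h1
      · rw [Subfield.smul_def, smul_eq_mul, div_mul_cancel₀ _ hne]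
    have hone : ∀ j, Module.finrank F (V j) ≤
        Module.finrank F ((V j).map (S j)) + if j = j₀ then 1 else 0 := by
      intro j
      have hrn := LinearMap.finrank_range_add_finrank_ker ((S j).domRestrict (V j))
      rw [LinearMap.range_domRestrict] at hrn
      rw [← hrn]
      refine Nat.add_le_add_left ?_ _
      split_ifs with hj
      · subst hj
        refine finrank_le_one ⟨⟨x₀, hx₀⟩, ?_⟩ ?_
        · rw [LinearMap.mem_ker, LinearMap.domRestrict_apply, hS, hbx, sub_self]
        · rintro ⟨⟨y, hy⟩, hyk⟩
          by_cases hy0 : y = 0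
          · exact ⟨0, Subtype.ext (Subtype.ext ((zero_smul F x₀).trans hy0.symm))⟩
          · obtain ⟨t, ht⟩ := (hker j y hy0 hyk).2
            exact ⟨t, Subtype.ext (Subtype.ext ht)⟩
      · rw [nonpos_iff_eq_zero, Submodule.finrank_eq_zero, Submodule.eq_bot_iff]
        rintro ⟨y, hy⟩ hyk
        by_contra h0
        exact hj (hker j y (fun h => h0 (Subtype.ext h)) hyk).1
    calc ∑ j, Module.finrank F (V j)
        ≤ ∑ j, (Module.finrank F ((V j).map (S j)) + if j = j₀ then 1 else 0) :=
          Finset.sum_le_sum fun j _ => hone j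
      _ ≤ d + 1 := by
          rw [Finset.sum_add_distrib, Finset.sum_ite_eq' Finset.univ j₀]
          simpa using hle

theorem skew_coeff_eq_zero_of_vanishing (hT : ∀ j y, T j y = c j * θ y) (hc : ∀ j, c j ≠ 0)
    (hF : ∀ x : K, x ∈ F ↔ θ x = x)
    (hinj : ∀ j j' u, u ≠ 0 → c j' * u = c j * θ u → j = j')
    (d : ℕ) (a : ℕ → K) (V : ι → Submodule F K) (hd : d ≤ ∑ j, Module.finrank F (V j))
    (hV : ∀ j, ∀ x ∈ V j, ∑ i ∈ Finset.range d, a i * (T j ^ i) x = 0) :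
    ∀ i < d, a i = 0 := by
  induction d with
  | zero => simp
  | succ d ih =>
    have had : a d = 0 := by
      by_contra h
      exact absurd (sum_finrank_le_of_skew_vanishing hT hc hF hinj d a h V hV) (by omega)
    have hlt := ih (by omega) fun j x hx => by
      simpa [Finset.sum_range_succ, had] using hV j x hx
    intro i hi
    rcases Nat.lt_succ_iff_lt_or_eq.1 hi with h | rfl
    · exact hlt i h
    · exact had

end

/-- Vanishing polynomial for multiple evaluation points, endomorphic case: given
nonzero `c_1, …, c_m` with pairwise distinct norms and `F`-subspaces `V_1, …, V_m` of
total dimension `n`, there is a unique monic relation of degree `n` vanishing on each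
`V_j` for the operator `μ_{c_j} ∘ θ`. -/
theorem vanishing_polynomial_multiple_points
    (K : Type*) [Field K] (θ : K ≃+* K) (s : ℕ) (hs : 2 ≤ s)
    (hord : ∀ x : K, (⇑θ)^[s] x = x)
    (hord' : ∀ i : ℕ, 0 < i → i < s → ∃ x : K, (⇑θ)^[i] x ≠ x)
    (F : Subfield K) (hF : ∀ x : K, x ∈ F ↔ θ x = x)
    [FiniteDimensional F K]
    (m : ℕ) (c : Fin m → K) (hc : ∀ j, c j ≠ 0)
    (hN : ∀ j j' : Fin m, j ≠ j' →
      (∏ i ∈ Finset.range s, (⇑θ)^[i] (c j)) ≠ (∏ i ∈ Finset.range s, (⇑θ)^[i] (c j')))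
    (V : Fin m → Submodule F K)
    (n : ℕ) (hn : n = ∑ j : Fin m, Module.finrank F (V j)) :
    ∃! a : Fin n → K, ∀ j : Fin m, ∀ x ∈ V j,
      (fun y => c j * θ y)^[n] x
        + ∑ i : Fin n, a i * (fun y => c j * θ y)^[(i : ℕ)] x = 0 := by
  let T : Fin m → Module.End F K := fun j =>
    { toFun := fun y => c j * θ y
      map_add' := fun x y => by rw [map_add, mul_add]
      map_smul' := fun t x => by
        rw [Subfield.smul_def, smul_eq_mul, map_mul, (hF t).1 t.2, RingHom.id_apply,
          Subfield.smul_def, smul_eq_mul, mul_left_comm] }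
  have hT : ∀ j y, T j y = c j * θ y := fun j y => rfl
  have hpow : ∀ j i x, (fun y => c j * θ y)^[i] x = (T j ^ i) x := fun j i x =>
    (Module.End.pow_apply (T j) i x).symm
  have hinj : ∀ j j' u, u ≠ 0 → c j' * u = c j * θ u → j = j' := fun j j' u hu h => by
    by_contra hjj
    exact hN j j' hjj (norm_eq_of_mul_eq_mul_map θ s hord hu h).symm
  let Φ : (Fin n → K) →ₗ[K] (∀ j, V j →ₗ[F] K) :=
    { toFun := fun a j => ∑ i : Fin n, a i • (T j ^ (i : ℕ)).domRestrict (V j)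
      map_add' := fun a a' => by
        ext j x
        simp [add_mul, Finset.sum_add_distrib]
      map_smul' := fun t a => by
        ext j x
        simp [Finset.mul_sum, mul_assoc] }
  have hΦ : ∀ a j (x : V j), Φ a j x = ∑ i : Fin n, a i * (T j ^ (i : ℕ)) x := fun a j x => by
    simp [Φ]
  have hΦinj : Function.Injective Φ := by
    rw [injective_iff_map_eq_zero]
    intro a ha
    have hzero := skew_coeff_eq_zero_of_vanishing hT hc hF hinj n
      (fun i => if h : i < n then a ⟨i, h⟩ else 0) V hn.le (fun j x hx => by
        rw [Finset.sum_range]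
        simpa [ha] using (hΦ a j ⟨x, hx⟩).symm)
    ext i
    simpa using hzero i i.2
  have hfin : ∀ j, Module.Finite K (V j →ₗ[F] K) := fun j => inferInstance
  have : Module.Finite K (∀ j, V j →ₗ[F] K) := Module.Finite.pi
  have hdim : Module.finrank K (Fin n → K) = Module.finrank K (∀ j, V j →ₗ[F] K) := by
    rw [Module.finrank_fin_fun, Module.finrank_pi_fintype, hn]
    exact Finset.sum_congr rfl fun j _ => (Module.finrank_linearMap_self F K (V j)).symm
  have hΦbij : Function.Bijective Φ :=
    ⟨hΦinj, (LinearMap.injective_iff_surjective_of_finrank_eq_finrank hdim).1 hΦinj⟩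
  convert hΦbij.existsUnique (fun j => -(T j ^ n).domRestrict (V j)) using 2 with a
  rw [funext_iff]
  refine forall_congr' fun j => ?_
  rw [LinearMap.ext_iff, Subtype.forall]
  refine forall₂_congr fun x hx => ?_
  rw [hΦ, LinearMap.neg_apply, LinearMap.domRestrict_apply, eq_neg_iff_add_eq_zero, add_comm]
  simp only [hpow]
end

section
/- With K, p, δ, F, r, the z_i and τ as in the context: for all a, c ∈ K, the trace (over F) of the F-linear endomorphism μ_a ∘ (δ + μ_c)^n of K is 0 for every integer n with 0 ≤ n ≤ p^r − 2, and the trace of μ_a ∘ (δ + μ_c)^{p^r − 1} equals τ(a) = Σ_{j=0}^{r} z_j·δ^{p^j−1}(a). -/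
namespace EvaluationDifferential

variable {K : Type*} [Field K] {F : Subfield K}

/-- The `K`-span of the powers `d ^ i` with `i < n`. -/
def lowerOrder (d : Module.End F K) (n : ℕ) : Submodule K (Module.End F K) :=
  Submodule.span K ((fun i : ℕ => d ^ i) '' Set.Iio n)

theorem lowerOrder_mono (d : Module.End F K) {m n : ℕ} (h : m ≤ n) :
    lowerOrder d m ≤ lowerOrder d n :=
  Submodule.span_mono (Set.image_mono (Set.Iio_subset_Iio h))

theorem pow_mem_lowerOrder (d : Module.End F K) {m n : ℕ} (h : m < n) :
    d ^ m ∈ lowerOrder d n :=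
  Submodule.subset_span ⟨m, h, rfl⟩

theorem mul_mem_lowerOrder_succ {d : Module.End F K}
    (hd : ∀ a b : K, d (a * b) = a * d b + d a * b) {n : ℕ} {φ : Module.End F K}
    (hφ : φ ∈ lowerOrder d n) : d * φ ∈ lowerOrder d (n + 1) := by
  induction hφ using Submodule.span_induction with
  | mem x hx =>
    obtain ⟨i, hi, rfl⟩ := hx
    have : d * d ^ i = d ^ (i + 1) := (pow_succ' d i).symm
    simp only [this]
    exact pow_mem_lowerOrder d (Nat.succ_lt_succ hi)
  | zero => simp
  | add x y _ _ hx hy => rw [mul_add]; exact add_mem hx hy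
  | smul k x hx ih =>
    have : d * (k • x) = k • (d * x) + d k • x := by
      ext y
      simp [hd]
    rw [this]
    exact add_mem (Submodule.smul_mem _ _ ih)
      (Submodule.smul_mem _ _ (lowerOrder_mono d n.le_succ hx))

theorem pow_mul_mulLeft_sub_mem {d : Module.End F K}
    (hd : ∀ a b : K, d (a * b) = a * d b + d a * b) (b : K) (n : ℕ) :
    d ^ n * LinearMap.mulLeft F b - b • d ^ n ∈ lowerOrder d n := by
  induction n with
  | zero =>
    have : d ^ 0 * LinearMap.mulLeft F b - b • d ^ 0 = 0 := by
      ext y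
      simp
    rw [this]
    exact zero_mem _
  | succ n ih =>
    have : d ^ (n + 1) * LinearMap.mulLeft F b - b • d ^ (n + 1) =
        d * (d ^ n * LinearMap.mulLeft F b - b • d ^ n) + d b • d ^ n := by
      ext y
      simp [pow_succ', hd]
      ring
    rw [this]
    exact add_mem (mul_mem_lowerOrder_succ hd ih)
      (Submodule.smul_mem _ _ (pow_mem_lowerOrder d n.lt_succ_self))

theorem add_mulLeft_pow_sub_mem {d : Module.End F K}
    (hd : ∀ a b : K, d (a * b) = a * d b + d a * b) (c : K) (n : ℕ) :
    (d + LinearMap.mulLeft F c) ^ n - d ^ n ∈ lowerOrder d n := by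
  induction n with
  | zero => simp
  | succ n ih =>
    have : (d + LinearMap.mulLeft F c) ^ (n + 1) - d ^ (n + 1) =
        d * ((d + LinearMap.mulLeft F c) ^ n - d ^ n) +
          (c • ((d + LinearMap.mulLeft F c) ^ n - d ^ n) + c • d ^ n) := by
      ext y
      simp [pow_succ']
      ring
    rw [this]
    exact add_mem (mul_mem_lowerOrder_succ hd ih)
      (add_mem (Submodule.smul_mem _ _ (lowerOrder_mono d n.le_succ ih))
        (Submodule.smul_mem _ _ (pow_mem_lowerOrder d n.lt_succ_self)))

/-- The Wronskian argument: the vectors of iterated derivatives of elements that are independent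
over the constants are independent over `K`. -/
theorem eq_zero_of_sum_mul_pow_apply_eq_zero {d : Module.End F K}
    (hd : ∀ a b : K, d (a * b) = a * d b + d a * b) (hF : ∀ x : K, d x = 0 → x ∈ F)
    {ι : Type*} {x : ι → K} (hx : LinearIndependent F x) (s : Finset ι) :
    ∀ k : ι → K, (∀ i : ℕ, ∑ j ∈ s, k j * (d ^ i) (x j) = 0) → ∀ j ∈ s, k j = 0 := by
  classical
  induction s using Finset.induction_on with
  | empty => simp
  | insert j₀ s hj₀ ih =>
    intro k hk
    by_cases h0 : k j₀ = 0
    · intro j hj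
      rcases Finset.mem_insert.1 hj with rfl | hj
      · exact h0
      · exact ih k (fun i => by simpa [Finset.sum_insert hj₀, h0] using hk i) j hj
    · exfalso
      have hd1 : d 1 = 0 := by simpa using hd 1 1
      have hk' : ∀ i : ℕ, ∑ j ∈ insert j₀ s, (k j / k j₀) * (d ^ i) (x j) = 0 := fun i => by
        simp_rw [div_mul_eq_mul_div, ← Finset.sum_div, hk i, zero_div]
      have hone : k j₀ / k j₀ = 1 := div_self h0
      have hs : ∀ j ∈ s, d (k j / k j₀) = 0 := by
        refine ih (fun j => d (k j / k j₀)) fun i => ?_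
        have h1 : d (∑ j ∈ insert j₀ s, (k j / k j₀) * (d ^ i) (x j)) = 0 := by
          rw [hk' i, map_zero]
        have h2 := hk' (i + 1)
        simp only [map_sum, hd, Finset.sum_add_distrib] at h1
        simp only [pow_succ', Module.End.mul_apply] at h2
        rw [h2, zero_add, Finset.sum_insert hj₀, hone, hd1, zero_mul, zero_add] at h1
        exact h1
      have hall : ∀ j ∈ insert j₀ s, k j / k j₀ ∈ F := by
        intro j hj
        rcases Finset.mem_insert.1 hj with rfl | hj
        · rw [hone]; exact one_mem F
        · exact hF _ (hs j hj)
      have hzero := linearIndependent_iff'.1 hx (insert j₀ s)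
        (fun j => if h : k j / k j₀ ∈ F then ⟨k j / k j₀, h⟩ else 0) (by
          rw [← hk' 0]
          refine Finset.sum_congr rfl fun j hj => ?_
          rw [dif_pos (hall j hj)]
          simp [Subfield.smul_def]) j₀ (Finset.mem_insert_self _ _)
      rw [dif_pos (hall j₀ (Finset.mem_insert_self _ _))] at hzero
      have := congrArg Subtype.val hzero
      simp only [hone] at this
      exact one_ne_zero this

theorem linearIndepOn_pow [FiniteDimensional F K] {d : Module.End F K}
    (hd : ∀ a b : K, d (a * b) = a * d b + d a * b) (hF : ∀ x : K, d x = 0 → x ∈ F)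
    (hpow : d ^ Module.finrank F K ∈ lowerOrder d (Module.finrank F K)) :
    LinearIndepOn K (fun i : ℕ => d ^ i) (Set.Iio (Module.finrank F K)) := by
  set N := Module.finrank F K with hN
  have hall : ∀ i : ℕ, d ^ i ∈ lowerOrder d N := by
    intro i
    induction i using Nat.strong_induction_on with
    | _ i ih =>
      rcases lt_or_ge i N with h | h
      · exact pow_mem_lowerOrder d h
      · obtain ⟨m, rfl⟩ := Nat.exists_eq_add_of_le' h
        have hle : ∀ φ ∈ lowerOrder d N, d * φ ∈ lowerOrder d N := by
          intro φ hφ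
          refine (Submodule.span_le.2 ?_ : lowerOrder d (N + 1) ≤ lowerOrder d N)
            (mul_mem_lowerOrder_succ hd hφ)
          rintro _ ⟨l, hl, rfl⟩
          rcases (Nat.lt_succ_iff.1 hl).lt_or_eq with h | rfl
          · exact pow_mem_lowerOrder d h
          · exact hpow
        cases m with
        | zero => simpa using hpow
        | succ m =>
          rw [show m + 1 + N = (m + N) + 1 by ring, pow_succ']
          exact hle _ (ih _ (by omega))
  let b := Module.finBasisOfFinrankEq F K hN.symm
  let M : Matrix (Fin N) (Fin N) K := fun i j => (d ^ (i : ℕ)) (b j)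
  have hM : M.det ≠ 0 := by
    intro h
    obtain ⟨v, hv, hMv⟩ := Matrix.exists_mulVec_eq_zero_iff.2 h
    have hvan : ∀ φ ∈ lowerOrder d N, ∑ j, v j * φ (b j) = 0 := by
      intro φ hφ
      induction hφ using Submodule.span_induction with
      | mem y hy =>
        obtain ⟨i, hi, rfl⟩ := hy
        have := congrFun hMv ⟨i, hi⟩
        simpa [Matrix.mulVec, dotProduct, M, mul_comm] using this
      | zero => simp
      | add y y' _ _ h h' => simp [mul_add, Finset.sum_add_distrib, h, h']
      | smul k y _ h =>
        simp only [LinearMap.smul_apply, smul_eq_mul, mul_left_comm _ k, ← Finset.mul_sum, h,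
          mul_zero]
    exact hv (funext fun j => eq_zero_of_sum_mul_pow_apply_eq_zero hd hF b.linearIndependent
      Finset.univ v (fun i => hvan _ (hall i)) j (Finset.mem_univ j))
  have hfin : LinearIndependent K (fun i : Fin N => d ^ (i : ℕ)) := by
    rw [Fintype.linearIndependent_iff]
    intro g hg
    by_contra hne
    refine hM (Matrix.exists_vecMul_eq_zero_iff.1 ⟨g, fun h => hne fun i => congrFun h i, ?_⟩)
    ext j
    have := LinearMap.congr_fun hg (b j)
    simpa [Matrix.vecMul, dotProduct, M] using this
  exact hfin.comp (fun i : Set.Iio N => (⟨i, i.2⟩ : Fin N))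
    (fun i j h => Subtype.ext (Fin.mk.inj_iff.1 h))

/-- If `t` is a nonzero functional such that `t ∘ μ_b ≡ b • t` modulo a `K`-subspace `P` not
containing `t`, then every endomorphism congruent to `u • t` modulo `P` has trace `t u`. -/
theorem trace_eq_of_sub_smul_mem [FiniteDimensional F K] (t : K →ₗ[F] F)
    {T : Module.End F K} (hT : ∀ x, T x = t x) {P : Submodule K (Module.End F K)}
    (hTP : T ∉ P) (hcomm : ∀ y : K, T * LinearMap.mulLeft F y - y • T ∈ P)
    {φ : Module.End F K} {u : K} (hφ : φ - u • T ∈ P) :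
    LinearMap.trace F K φ = t u := by
  classical
  let B : LinearMap.BilinForm F K := (LinearMap.mul F K).compr₂ t
  have hBapp : ∀ x y, B x y = t (x * y) := fun x y => rfl
  have hB : B.Nondegenerate := by
    have hT0 : T ≠ 0 := fun h => hTP (h ▸ zero_mem P)
    have key : ∀ x : K, (∀ y, t (x * y) = 0) → x = 0 := by
      intro x hx
      by_contra hx0
      refine hT0 (LinearMap.ext fun y => ?_)
      rw [hT, ← mul_inv_cancel_left₀ hx0 y, hx]
      simp
    exact ⟨key, fun x hx => key x fun y => by rw [mul_comm]; exact hx y⟩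
  let b := Module.finBasis F K
  let y := B.dualBasis hB b
  have hrepr : ∀ (x : K) j, b.repr x j = t (y j * x) := by
    intro x j
    conv_rhs => rw [← b.sum_repr x]
    rw [← hBapp, map_sum]
    simp [y, LinearMap.BilinForm.apply_dualBasis_left]
  have htr : LinearMap.trace F K φ = t (∑ j, φ (b j) * y j) := by
    rw [LinearMap.trace_eq_matrix_trace F b, Matrix.trace, map_sum]
    refine Finset.sum_congr rfl fun j _ => ?_
    rw [Matrix.diag_apply, LinearMap.toMatrix_apply, hrepr, mul_comm]
  have hexp : φ = ∑ j, φ (b j) • (T * LinearMap.mulLeft F (y j)) := by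
    ext x
    conv_lhs => rw [← b.sum_repr x]
    rw [map_sum]
    simp only [LinearMap.sum_apply, LinearMap.smul_apply,
      Module.End.mul_apply, LinearMap.mulLeft_apply, hT, hrepr, Subfield.smul_def, smul_eq_mul]
    exact Finset.sum_congr rfl fun j _ => by
      rw [← smul_eq_mul, ← Subfield.smul_def, map_smul, Subfield.smul_def, smul_eq_mul, mul_comm]
  have hφ' : φ - (∑ j, φ (b j) * y j) • T ∈ P := by
    have : φ - (∑ j, φ (b j) * y j) • T =
        ∑ j, φ (b j) • (T * LinearMap.mulLeft F (y j) - y j • T) := by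
      simp only [smul_sub, Finset.sum_sub_distrib, smul_smul, ← hexp, Finset.sum_smul]
    rw [this]
    exact sum_mem fun j _ => P.smul_mem _ (hcomm _)
  have hdiff : ((∑ j, φ (b j) * y j) - u) • T ∈ P := by
    have : ((∑ j, φ (b j) * y j) - u) • T =
        (φ - u • T) - (φ - (∑ j, φ (b j) * y j) • T) := by
      ext x
      simp only [LinearMap.sub_apply, LinearMap.smul_apply, smul_eq_mul]
      ring
    rw [this]
    exact sub_mem hφ hφ'
  have hu : (∑ j, φ (b j) * y j) = u := by
    by_contra hne
    exact hTP ((P.smul_mem_iff (sub_ne_zero.2 hne)).1 hdiff)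
  rw [htr, hu]

end EvaluationDifferential


/-- Reduced trace via explicit traces, differential case: the `F`-linear endomorphism
`μ_a ∘ (δ + μ_c)^n` of `K` has trace `0` for `0 ≤ n ≤ p^r - 2`, and trace
`τ(a) = Σ_{j≤r} z_j δ^{p^j-1}(a)` for `n = p^r - 1`. -/
theorem trace_of_evaluation_differential
    (p : ℕ) (hp : p.Prime) (K : Type*) [Field K] [CharP K p]
    (δ : K → K)
    (hadd : ∀ a b : K, δ (a + b) = δ a + δ b)
    (hleib : ∀ a b : K, δ (a * b) = a * δ b + δ a * b)
    (hδ : δ ≠ 0)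
    (F : Subfield K) (hF : ∀ x : K, x ∈ F ↔ δ x = 0)
    [FiniteDimensional F K] (r : ℕ) (hrk : Module.finrank F K = p ^ r)
    (z : ℕ → K) (hzF : ∀ i, i < r → δ (z i) = 0) (hzr : z r = 1)
    (hrel : ∀ x : K, δ^[p ^ r] x + ∑ i ∈ Finset.range r, z i * δ^[p ^ i] x = 0)
    (a c : K) :
    (∀ n : ℕ, n ≤ p ^ r - 2 →
      ∀ φ : K →ₗ[F] K, (∀ x : K, φ x = a * (fun y => δ y + c * y)^[n] x) →
        LinearMap.trace F K φ = 0) ∧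
    (∀ ψ : K →ₗ[F] K, (∀ x : K, ψ x = a * (fun y => δ y + c * y)^[p ^ r - 1] x) →
      ((LinearMap.trace F K ψ : K)
        = ∑ j ∈ Finset.range (r + 1), z j * δ^[p ^ j - 1] a)) := by
  have hr : r ≠ 0 := by
    rintro rfl
    exact hδ (funext fun x => by simpa using hrel x)
  have hN : 2 ≤ p ^ r := hp.two_le.trans (Nat.le_self_pow hr p)
  let d : Module.End F K :=
    { toFun := δ
      map_add' := hadd
      map_smul' := fun f x => by
        simp [Subfield.smul_def, hleib, (hF f).1 f.2] }
  have hd : ∀ x y : K, d (x * y) = x * d y + d x * y := hleib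
  have hpow : ∀ (n : ℕ) (x : K), (d ^ n) x = δ^[n] x := fun n x => by
    rw [Module.End.pow_apply]; rfl
  have hlt : ∀ i < r, p ^ i < p ^ r := fun i hi => Nat.pow_lt_pow_right hp.one_lt hi
  have hind := EvaluationDifferential.linearIndepOn_pow hd (fun x hx => (hF x).2 hx) (by
    rw [hrk]
    have : d ^ p ^ r = -∑ i ∈ Finset.range r, z i • d ^ p ^ i := by
      ext x
      simpa [hpow] using eq_neg_of_add_eq_zero_left (hrel x)
    rw [this]
    exact neg_mem (sum_mem fun i hi => Submodule.smul_mem _ _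
      (EvaluationDifferential.pow_mem_lowerOrder d (hlt i (Finset.mem_range.1 hi)))))
  rw [hrk] at hind
  let P := EvaluationDifferential.lowerOrder d (p ^ r - 1)
  have htop : d ^ (p ^ r - 1) ∉ P := by
    refine (LinearIndepOn.mono hind ?_ : LinearIndepOn K (fun i : ℕ => d ^ i)
      (insert (p ^ r - 1) (Set.Iio (p ^ r - 1)))).notMem_span_of_insert (by simp)
    intro i hi
    simp only [Set.mem_insert_iff, Set.mem_Iio] at hi ⊢
    omega
  let T : Module.End F K := ∑ j ∈ Finset.range (r + 1), z j • d ^ (p ^ j - 1)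
  have hTapp : ∀ x, T x = ∑ j ∈ Finset.range (r + 1), z j * δ^[p ^ j - 1] x := fun x => by
    simp [T, hpow]
  have hTsub : T - d ^ (p ^ r - 1) ∈ P := by
    have : T - d ^ (p ^ r - 1) = ∑ j ∈ Finset.range r, z j • d ^ (p ^ j - 1) := by
      simp [T, Finset.sum_range_succ, hzr]
    rw [this]
    refine sum_mem fun j hj => Submodule.smul_mem _ _
      (EvaluationDifferential.pow_mem_lowerOrder d ?_)
    have := hlt j (Finset.mem_range.1 hj)
    have := Nat.pow_pos (n := j) hp.pos
    omega
  have hTP : T ∉ P := fun h => htop (by simpa using sub_mem h hTsub)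
  have hcomm : ∀ y : K, T * LinearMap.mulLeft F y - y • T ∈ P := by
    intro y
    have : T * LinearMap.mulLeft F y - y • T = ∑ j ∈ Finset.range (r + 1),
        z j • (d ^ (p ^ j - 1) * LinearMap.mulLeft F y - y • d ^ (p ^ j - 1)) := by
      simp only [T, Finset.sum_mul, Finset.smul_sum, smul_sub, Finset.sum_sub_distrib,
        smul_mul_assoc, smul_comm y]
    rw [this]
    refine sum_mem fun j hj => Submodule.smul_mem _ _
      (EvaluationDifferential.lowerOrder_mono d ?_
        (EvaluationDifferential.pow_mul_mulLeft_sub_mem hd y _))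
    exact Nat.sub_le_sub_right
      (Nat.pow_le_pow_right hp.pos (Nat.lt_succ_iff.1 (Finset.mem_range.1 hj))) 1
  have hzF' : ∀ i ≤ r, d (z i) = 0 := by
    intro i hi
    rcases hi.lt_or_eq with hi | rfl
    · exact hzF i hi
    · rw [hzr]; simpa using hd 1 1
  have hTF : ∀ x, T x ∈ F := by
    intro x
    rw [hF]
    change d (T x) = 0
    have hstep : ∀ j ∈ Finset.range (r + 1), d (z j * δ^[p ^ j - 1] x) = z j * δ^[p ^ j] x := by
      intro j hj
      rw [hd, hzF' j (Nat.lt_succ_iff.1 (Finset.mem_range.1 hj)), zero_mul, add_zero]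
      change z j * δ (δ^[p ^ j - 1] x) = _
      rw [← Function.iterate_succ_apply' δ, Nat.succ_eq_add_one,
        Nat.sub_add_cancel (Nat.pow_pos hp.pos)]
    rw [hTapp, map_sum, Finset.sum_congr rfl hstep, Finset.sum_range_succ, hzr, one_mul,
      add_comm, hrel]
  let t : K →ₗ[F] F :=
    { toFun := fun x => ⟨T x, hTF x⟩
      map_add' := fun x y => Subtype.ext (map_add T x y)
      map_smul' := fun f x => Subtype.ext (map_smul T f x) }
  have hD : ∀ (n : ℕ) (φ : Module.End F K),
      (∀ x, φ x = a * (fun y => δ y + c * y)^[n] x) →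
      φ = a • (d + LinearMap.mulLeft F c) ^ n := by
    intro n φ hφ
    ext x
    rw [hφ, LinearMap.smul_apply, Module.End.pow_apply]
    rfl
  refine ⟨fun n hn φ hφ => ?_, fun ψ hψ => ?_⟩
  · rw [EvaluationDifferential.trace_eq_of_sub_smul_mem t (T := T) (fun x => rfl) hTP hcomm
      (u := 0) (φ := φ), map_zero]
    rw [zero_smul, sub_zero, hD n φ hφ]
    refine Submodule.smul_mem _ _ ?_
    have := add_mem (EvaluationDifferential.lowerOrder_mono d (by omega : n ≤ p ^ r - 1)
      (EvaluationDifferential.add_mulLeft_pow_sub_mem hd c n))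
      (EvaluationDifferential.pow_mem_lowerOrder d (by omega : n < p ^ r - 1))
    rwa [sub_add_cancel] at this
  · rw [EvaluationDifferential.trace_eq_of_sub_smul_mem t (T := T) (fun x => rfl) hTP hcomm
      (u := a) (φ := ψ), ← hTapp]
    · rfl
    · have : ψ - a • T = a • ((d + LinearMap.mulLeft F c) ^ (p ^ r - 1) - T) := by
        ext x
        simp only [hD _ ψ hψ, LinearMap.sub_apply, LinearMap.smul_apply, smul_eq_mul, mul_sub]
      rw [this]
      refine Submodule.smul_mem _ _ ?_
      have := sub_mem (EvaluationDifferential.add_mulLeft_pow_sub_mem hd c (p ^ r - 1)) hTsub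
      rwa [sub_sub_sub_cancel_right] at this
end

section
/- Let K, θ, s, F, N, Tr_{K/F} be as in the context. For all a, c ∈ K: (1) the trace over F of the F-linear endomorphism μ_a ∘ (μ_c ∘ θ)^i of K is 0 for every integer i with 0 < i < s; (2) the trace over F of μ_a equals Tr_{K/F}(a); (3) the trace over F of μ_a ∘ (μ_c ∘ θ)^s equals N(c)·Tr_{K/F}(a). -/
/-- A nontrivial algebra endomorphism `τ` of a field, followed by multiplication by a scalar,
has trace zero. -/
theorem trace_mul_algHom_eq_zero {F K : Type*} [Field F] [Field K] [Algebra F K]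
    (τ : K →ₐ[F] K) {y : K} (hy : τ y ≠ y) (b : K) :
    LinearMap.trace F K (LinearMap.mulLeft F b ∘ₗ τ.toLinearMap) = 0 := by
  have hne : τ y - y ≠ 0 := sub_ne_zero.mpr hy
  set f := LinearMap.mulLeft F (b / (τ y - y)) ∘ₗ τ.toLinearMap
  have hdecomp : LinearMap.mulLeft F b ∘ₗ τ.toLinearMap
      = f * LinearMap.mulLeft F y - LinearMap.mulLeft F y * f := by
    ext x
    simp only [f, LinearMap.comp_apply, LinearMap.mulLeft_apply, AlgHom.toLinearMap_apply,
      LinearMap.sub_apply, Module.End.mul_apply, map_mul]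
    field_simp
  rw [hdecomp, map_sub, LinearMap.trace_mul_comm, sub_self]

/-- The trace of an extension whose base field is the fixed field of an automorphism `σ` of finite
order is the sum of the powers of `σ`. -/
theorem algebraMap_trace_eq_sum_pow {F K : Type*} [Field F] [Field K] [Algebra F K]
    [FiniteDimensional F K] (σ : K ≃ₐ[F] K)
    (hfix : ∀ x : K, σ x = x → x ∈ (algebraMap F K).range) (a : K) :
    algebraMap F K (Algebra.trace F K a) = ∑ i ∈ Finset.range (orderOf σ), (σ ^ i) a := by
  classical
  have hbot : IntermediateField.fixedField (Subgroup.zpowers σ) = ⊥ := by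
    refine le_bot_iff.mp fun x hx => ?_
    exact IntermediateField.mem_bot.mpr (hfix x (hx ⟨σ, Subgroup.mem_zpowers σ⟩))
  have htop : Subgroup.zpowers σ = ⊤ := by
    rw [← IntermediateField.fixingSubgroup_fixedField (Subgroup.zpowers σ), hbot,
      IntermediateField.fixingSubgroup_bot]
  have : IsGalois F K := IsGalois.of_fixedField_eq_bot F K (htop ▸ hbot)
  have huniv : (Finset.range (orderOf σ)).image (σ ^ ·) = Finset.univ := by
    rw [image_range_orderOf]
    ext τ
    simp [htop]
  rw [trace_eq_sum_automorphisms, ← huniv, Finset.sum_image]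
  exact fun i hi j hj h => pow_injOn_Iio_orderOf (by simpa using hi) (by simpa using hj) h

/-- Iterates of a semilinear map `y ↦ c * θ y` on a commutative ring. -/
theorem iterate_mul_ringEquiv {K : Type*} [CommRing K] (θ : K ≃+* K) (c x : K) (n : ℕ) :
    (fun y => c * θ y)^[n] x = (∏ i ∈ Finset.range n, (⇑θ)^[i] c) * (⇑θ)^[n] x := by
  induction n with
  | zero => simp
  | succ n ih =>
    rw [Function.iterate_succ_apply', ih, Finset.prod_range_succ', map_mul, map_prod]
    simp only [Function.iterate_succ_apply', Function.iterate_zero, id_eq]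
    ring

/-- Reduced trace via explicit traces, endomorphic case: the `F`-linear endomorphism
`μ_a ∘ (μ_c ∘ θ)^i` of `K` has trace `0` for `0 < i < s`; the trace of `μ_a` is
`Tr_{K/F}(a)`; and the trace of `μ_a ∘ (μ_c ∘ θ)^s` is `N(c)·Tr_{K/F}(a)`. -/
theorem trace_of_evaluation_endomorphic
    (K : Type*) [Field K] (θ : K ≃+* K) (s : ℕ) (hs : 2 ≤ s)
    (hord : ∀ x : K, (⇑θ)^[s] x = x)
    (hord' : ∀ i : ℕ, 0 < i → i < s → ∃ x : K, (⇑θ)^[i] x ≠ x)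
    (F : Subfield K) (hF : ∀ x : K, x ∈ F ↔ θ x = x)
    [FiniteDimensional F K]
    (a c : K) :
    (∀ i : ℕ, 0 < i → i < s →
      ∀ φ : K →ₗ[F] K, (∀ x : K, φ x = a * (fun y => c * θ y)^[i] x) →
        LinearMap.trace F K φ = 0) ∧
    (∀ φ : K →ₗ[F] K, (∀ x : K, φ x = a * x) →
      ((LinearMap.trace F K φ : K) = ∑ i ∈ Finset.range s, (⇑θ)^[i] a)) ∧
    (∀ φ : K →ₗ[F] K, (∀ x : K, φ x = a * (fun y => c * θ y)^[s] x) →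
      ((LinearMap.trace F K φ : K)
        = (∏ i ∈ Finset.range s, (⇑θ)^[i] c) * ∑ i ∈ Finset.range s, (⇑θ)^[i] a)) := by
  let σ : K ≃ₐ[F] K := AlgEquiv.ofRingEquiv (f := θ) fun r => (hF r).mp r.2
  have hσ : ∀ (i : ℕ) (x : K), (σ ^ i) x = (⇑θ)^[i] x := fun i x => by
    rw [AlgEquiv.coe_pow]
    rfl
  have horder : orderOf σ = s := by
    refine (orderOf_eq_iff (by omega)).mpr ⟨AlgEquiv.ext fun x => (hσ s x).trans (hord x), ?_⟩
    intro i his hi h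
    obtain ⟨x, hx⟩ := hord' i hi his
    exact hx (by rw [← hσ, h, AlgEquiv.one_apply])
  have htrace : ∀ (b : K) (φ : K →ₗ[F] K), (∀ x : K, φ x = b * x) →
      ((LinearMap.trace F K φ : K) = ∑ i ∈ Finset.range s, (⇑θ)^[i] b) := by
    intro b φ hφ
    have h := algebraMap_trace_eq_sum_pow σ (fun x hx => ⟨⟨x, (hF x).mpr hx⟩, rfl⟩) b
    have hφ' : φ = Algebra.lmul F K b := LinearMap.ext hφ
    rw [horder] at h
    simp only [hσ] at h
    rw [hφ', ← h]
    rfl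
  refine ⟨fun i hi his φ hφ => ?_, htrace a, fun φ hφ => ?_⟩
  · obtain ⟨y, hy⟩ := hord' i hi his
    have hφ' : φ = LinearMap.mulLeft F (a * ∏ j ∈ Finset.range i, (⇑θ)^[j] c) ∘ₗ
        ((σ ^ i : K ≃ₐ[F] K) : K →ₐ[F] K).toLinearMap := by
      ext x
      rw [hφ, iterate_mul_ringEquiv, ← hσ i x, ← mul_assoc]
      rfl
    rw [hφ']
    exact trace_mul_algHom_eq_zero _ (y := y) ((hσ i y).trans_ne hy) _
  · set n := ∏ i ∈ Finset.range s, (⇑θ)^[i] c with hn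
    have hfixed : θ n = n := by
      rw [hn, map_prod]
      simp only [← Function.iterate_succ_apply' (⇑θ)]
      obtain ⟨t, rfl⟩ : ∃ t, s = t + 1 := ⟨s - 1, by omega⟩
      rw [Finset.prod_range_succ, hord, Finset.prod_range_succ']
      rfl
    rw [htrace (n * a) φ fun x => by rw [hφ, iterate_mul_ringEquiv, hord]; ring, Finset.mul_sum]
    refine Finset.sum_congr rfl fun i _ => ?_
    rw [iterate_map_mul, Function.iterate_fixed hfixed]
end

section
/- With K, p, δ, F, r, the z_i and τ as in the context: the map τ is F-linear, takes its values in F, is surjective onto F, and its kernel equals the image δ(K) of the derivation δ. -/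
/-- Elements linearly independent over the constants of a derivation have no nontrivial relation
between their sequences of iterated derivatives. -/
theorem eq_zero_of_forall_sum_mul_iterate_eq_zero {K ι : Type*} [Field K] (δ : K →+ K)
    (hleib : ∀ a b : K, δ (a * b) = a * δ b + δ a * b)
    (F : Subfield K) (hF : ∀ x : K, δ x = 0 → x ∈ F)
    (x : ι → K) (hx : LinearIndependent F x) (s : Finset ι) :
    ∀ c : ι → K, (∀ i : ℕ, ∑ j ∈ s, c j * δ^[i] (x j) = 0) → ∀ j ∈ s, c j = 0 := by
  classical
  induction s using Finset.induction_on with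
  | empty => simp
  | insert k s hk ih =>
    intro c hc
    have h_one : δ 1 = 0 := by simpa using hleib 1 1
    by_cases hck : c k = 0
    · have h := ih c fun i => by simpa [Finset.sum_insert hk, hck] using hc i
      simpa [hck] using h
    exfalso
    set d : ι → K := fun j => (c k)⁻¹ * c j with hd
    have hdk : d k = 1 := inv_mul_cancel₀ hck
    have hdrel : ∀ i : ℕ, ∑ j ∈ insert k s, d j * δ^[i] (x j) = 0 := fun i => by
      simp only [hd, mul_assoc, ← Finset.mul_sum, hc i, mul_zero]
    have hderiv : ∀ j ∈ s, δ (d j) = 0 := by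
      refine ih (fun j => δ (d j)) fun i => ?_
      have h := congrArg δ (hdrel i)
      simp only [map_sum, hleib, Finset.sum_add_distrib, map_zero,
        ← Function.iterate_succ_apply' δ, hdrel (i + 1), zero_add] at h
      simpa [Finset.sum_insert hk, hdk, h_one] using h
    have hmem : ∀ j ∈ insert k s, d j ∈ F := by
      intro j hj
      rcases Finset.mem_insert.1 hj with rfl | hj
      · exact hdk ▸ F.one_mem
      · exact hF _ (hderiv j hj)
    have hzero := linearIndependent_iff'.1 hx (insert k s)
      (fun j => if h : d j ∈ F then ⟨d j, h⟩ else 0) (by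
        rw [← hdrel 0]
        refine Finset.sum_congr rfl fun j hj => ?_
        simp [hmem j hj, Subfield.smul_def]) k (Finset.mem_insert_self k s)
    rw [dif_pos (hmem k (Finset.mem_insert_self k s))] at hzero
    exact one_ne_zero (hdk.symm.trans (congrArg Subtype.val hzero))

/-- If a monic linear differential operator of order `n` vanishes on `K`, then `K` has degree at
most `n` over the constants. -/
theorem finrank_constants_le_of_iterate_eq_sum {K ι : Type*} [Field K] (δ : K →+ K)
    (hleib : ∀ a b : K, δ (a * b) = a * δ b + δ a * b)
    (F : Subfield K) (hF : ∀ x : K, δ x = 0 → x ∈ F) [FiniteDimensional F K]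
    (n : ℕ) (t : Finset ι) (w : ι → K) (e : ι → ℕ) (he : ∀ i ∈ t, e i < n)
    (hrel : ∀ x : K, δ^[n] x = ∑ i ∈ t, w i * δ^[e i] x) :
    Module.finrank F K ≤ n := by
  by_contra! hlt
  let x := Module.finBasis F K
  let M : Matrix (Fin n) (Fin (Module.finrank F K)) K := Matrix.of fun i j => δ^[i] (x j)
  obtain ⟨c, hc, hc0⟩ := Submodule.exists_mem_ne_zero_of_ne_bot
    (M.mulVecLin.ker_ne_bot_of_finrank_lt (by simpa using hlt))
  have hlow : ∀ i < n, ∑ j, c j * δ^[i] (x j) = 0 := fun i hi => by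
    simpa [M, Matrix.mulVec, dotProduct, mul_comm] using congrFun (LinearMap.mem_ker.1 hc) ⟨i, hi⟩
  have hall : ∀ i, ∑ j, c j * δ^[i] (x j) = 0 := by
    intro i
    induction i using Nat.strong_induction_on with
    | _ i ih =>
      rcases lt_or_ge i n with hi | hi
      · exact hlow i hi
      obtain ⟨m, rfl⟩ := Nat.exists_eq_add_of_le hi
      simp only [Function.iterate_add_apply, hrel, Finset.mul_sum]
      rw [Finset.sum_comm]
      refine Finset.sum_eq_zero fun l hl => ?_
      have h := ih (e l + m) (by have := he l hl; omega)
      simp only [mul_left_comm _ (w l), ← Finset.mul_sum, ← Function.iterate_add_apply, h, mul_zero]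
  exact hc0 (funext fun j => eq_zero_of_forall_sum_mul_iterate_eq_zero δ hleib F hF x
    x.linearIndependent Finset.univ c hall j (Finset.mem_univ j))


/-- Properties of the differential trace `τ(a) = Σ_{i≤r} z_i δ^{p^i-1}(a)`: it is
`F`-linear, takes values in `F`, maps `K` onto `F`, and its kernel is the image
of `δ`. -/
theorem differential_trace_properties
    (p : ℕ) (hp : p.Prime) (K : Type*) [Field K] [CharP K p]
    (δ : K → K)
    (hadd : ∀ a b : K, δ (a + b) = δ a + δ b)
    (hleib : ∀ a b : K, δ (a * b) = a * δ b + δ a * b)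
    (hδ : δ ≠ 0)
    (F : Subfield K) (hF : ∀ x : K, x ∈ F ↔ δ x = 0)
    [FiniteDimensional F K] (r : ℕ) (hrk : Module.finrank F K = p ^ r)
    (z : ℕ → K) (hzF : ∀ i, i < r → δ (z i) = 0) (hzr : z r = 1)
    (hrel : ∀ x : K, δ^[p ^ r] x + ∑ i ∈ Finset.range r, z i * δ^[p ^ i] x = 0)
    (τ : K → K) (hτ : ∀ a : K, τ a = ∑ i ∈ Finset.range (r + 1), z i * δ^[p ^ i - 1] a) :
    (∀ a b : K, τ (a + b) = τ a + τ b) ∧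
    (∀ lam a : K, lam ∈ F → τ (lam * a) = lam * τ a) ∧
    (∀ a : K, τ a ∈ F) ∧
    (∀ y : K, y ∈ F → ∃ a : K, τ a = y) ∧
    (∀ a : K, τ a = 0 ↔ ∃ b : K, δ b = a) := by
  have hmulF : ∀ c a : K, δ c = 0 → δ (c * a) = c * δ a := fun c a hc => by simp [hleib, hc]
  let D : K →ₗ[F] K :=
    { toFun := δ
      map_add' := hadd
      map_smul' := fun c a => hmulF c a ((hF c).1 c.2) }
  have hDpow : ∀ (n : ℕ) (a : K), (D ^ n) a = δ^[n] a := fun n a => by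
    rw [Module.End.pow_apply]; rfl
  have hzF' : ∀ i ∈ Finset.range (r + 1), δ (z i) = 0 := by
    intro i hi
    rcases (Nat.lt_succ_iff_lt_or_eq.1 (Finset.mem_range.1 hi)) with h | rfl
    · exact hzF i h
    · simpa [hzr] using hleib 1 1
  have hτadd : ∀ a b : K, τ (a + b) = τ a + τ b := fun a b => by
    simp only [hτ, ← hDpow, map_add, mul_add, Finset.sum_add_distrib]
  have hτsmul : ∀ c a : K, c ∈ F → τ (c * a) = c * τ a := fun c a hc => by
    have h : ∀ n, (D ^ n) (c * a) = c * (D ^ n) a := fun n => (D ^ n).map_smul ⟨c, hc⟩ a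
    simp only [hτ, ← hDpow, h, Finset.mul_sum, mul_left_comm c]
  have hop : ∀ a : K, ∑ i ∈ Finset.range (r + 1), z i * δ^[p ^ i] a = 0 := fun a => by
    rw [Finset.sum_range_succ, hzr, one_mul, add_comm, hrel]
  have hpos : ∀ i, p ^ i - 1 + 1 = p ^ i := fun i => Nat.sub_add_cancel (pow_pos hp.pos i)
  have hτF : ∀ a : K, τ a ∈ F := fun a => by
    rw [hF, hτ]
    change D _ = 0
    rw [map_sum, ← hop a]
    refine Finset.sum_congr rfl fun i hi => ?_
    change δ _ = _
    rw [hmulF _ _ (hzF' i hi), ← Function.iterate_succ_apply' δ, Nat.succ_eq_add_one, hpos]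
  have hτδ : ∀ b : K, τ (δ b) = 0 := fun b => by
    rw [hτ, ← hop b]
    refine Finset.sum_congr rfl fun i _ => ?_
    rw [← Function.iterate_succ_apply δ, Nat.succ_eq_add_one, hpos]
  obtain ⟨a₀, ha₀⟩ : ∃ a, τ a ≠ 0 := by
    by_contra! hzero
    have h := finrank_constants_le_of_iterate_eq_sum (AddMonoidHom.mk' δ hadd) hleib F
      (fun x hx => (hF x).2 hx) (p ^ r - 1) (Finset.range r) (fun i => - z i)
      (fun i => p ^ i - 1)
      (fun i hi => Nat.sub_lt_sub_right (Nat.one_le_pow _ _ hp.pos)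
        (Nat.pow_lt_pow_right hp.one_lt (Finset.mem_range.1 hi)))
      (fun x => by
        have h := (hτ x).symm.trans (hzero x)
        rw [Finset.sum_range_succ, hzr, one_mul, add_comm] at h
        simpa [Finset.sum_neg_distrib] using eq_neg_of_add_eq_zero_left h)
    have := hpos r
    omega
  let T : K →ₗ[F] K :=
    { toFun := τ
      map_add' := hτadd
      map_smul' := fun c a => hτsmul c a c.2 }
  refine ⟨hτadd, hτsmul, hτF, fun y hy => ⟨y / τ a₀ * a₀, ?_⟩, fun a => ⟨fun ha => ?_, ?_⟩⟩
  · rw [hτsmul _ _ (F.div_mem hy (hτF a₀)), div_mul_cancel₀ _ ha₀]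
  · have hle : D.range ≤ T.ker := by
      rintro _ ⟨b, rfl⟩
      exact hτδ b
    have hker : Module.finrank F D.ker ≤ 1 :=
      finrank_le_one ⟨1, by simpa [D] using hleib 1 1⟩ fun v =>
        ⟨⟨v, (hF v).2 v.2⟩, Subtype.ext (mul_one (v : K))⟩
    have hrange : 0 < Module.finrank F T.range := by
      have : Nontrivial T.range :=
        ⟨⟨⟨τ a₀, a₀, rfl⟩, 0, fun h => ha₀ (congrArg Subtype.val h)⟩⟩
      exact Module.finrank_pos
    have hD := D.finrank_range_add_finrank_ker
    have hT := T.finrank_range_add_finrank_ker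
    have heq := Submodule.eq_of_le_of_finrank_le hle (by omega)
    have hmem : a ∈ D.range := heq ▸ (LinearMap.mem_ker.2 ha : a ∈ T.ker)
    exact hmem
  · rintro ⟨b, rfl⟩
    exact hτδ b
end

section
/- With K, p, δ, F, r, the z_i and τ as in the context: the pairing K × K → F, (f, g) ↦ τ(f·g), is F-bilinear and nondegenerate; in particular, if f ∈ K satisfies τ(f·g) = 0 for all g ∈ K, then f = 0. -/
/-- A Wronskian criterion: if `y` is linearly independent over the constants of `D`, the columns
`(D^[i] (y j))ᵢ` of the Wronskian matrix of `y` are linearly independent. -/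
theorem Derivation.eq_zero_of_wronskian_relation {K : Type*} [Field K] (D : Derivation ℤ K K) :
    ∀ (n : ℕ) (y : Fin n → K),
      (∀ d : Fin n → K, (∀ j, D (d j) = 0) → ∑ j, d j * y j = 0 → d = 0) →
      ∀ c : Fin n → K, (∀ i < n, ∑ j, c j * D^[i] (y j) = 0) → c = 0 := by
  intro n
  induction n with
  | zero => intro y _ c _; exact Subsingleton.elim _ _
  | succ n ih =>
    intro y hy c hc
    have hy' : ∀ d : Fin n → K, (∀ j, D (d j) = 0) →
        ∑ j, d j * y j.castSucc = 0 → d = 0 := by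
      intro d hd hs
      have h := hy (Fin.snoc d 0)
        (fun j => by refine Fin.lastCases ?_ (fun j => ?_) j <;> simp [hd])
        (by simpa [Fin.sum_univ_castSucc] using hs)
      funext j
      simpa using congrFun h j.castSucc
    by_cases hlast : c (Fin.last n) = 0
    · have h := ih (fun j => y j.castSucc) hy' (fun j => c j.castSucc) fun i hi => by
        simpa [Fin.sum_univ_castSucc, hlast] using hc i (by omega)
      funext j
      refine Fin.lastCases hlast (fun j => congrFun h j) j
    · exfalso
      set e : Fin (n + 1) → K := fun j => (c (Fin.last n))⁻¹ * c j with he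
      have he1 : e (Fin.last n) = 1 := inv_mul_cancel₀ hlast
      have hes : ∀ i < n + 1, ∑ j, e j * D^[i] (y j) = 0 := fun i hi => by
        simp only [he, mul_assoc, ← Finset.mul_sum, hc i hi, mul_zero]
      have hDe := ih (fun j => y j.castSucc) hy' (fun j => D (e j.castSucc)) fun i hi => by
        have h := congrArg D (hes i (by omega))
        have h' := hes (i + 1) (by omega)
        simp only [Function.iterate_succ_apply'] at h'
        simp only [map_sum, Derivation.leibniz, smul_eq_mul, Finset.sum_add_distrib, h',
          map_zero, zero_add] at h
        simpa [Fin.sum_univ_castSucc, he1, mul_comm] using h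
      have h0 := hy e
        (fun j => Fin.lastCases (by simp [he1]) (fun j => congrFun hDe j) j)
        (by simpa using hes 0 (by omega))
      simpa [he1] using congrFun h0 (Fin.last n)

/-- If `K` has degree `n` over the constants of `D`, then `1, D, …, D ^ (n - 1)` are linearly
independent over `K`. -/
theorem Derivation.eq_zero_of_sum_mul_iterate_eq_zero_s17 {K : Type*} [Field K]
    (D : Derivation ℤ K K) (F : Subfield K) (hF : ∀ x, x ∈ F ↔ D x = 0)
    [FiniteDimensional F K] (n : ℕ) (hn : Module.finrank F K = n) (a : Fin n → K)
    (ha : ∀ x, ∑ i, a i * D^[(i : ℕ)] x = 0) : a = 0 := by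
  let b := Module.finBasisOfFinrankEq F K hn
  by_contra hne
  obtain ⟨c, hc0, hc⟩ := Matrix.exists_mulVec_eq_zero_iff.2
    (Matrix.exists_vecMul_eq_zero_iff.1
      ⟨a, hne, show Matrix.vecMul a (Matrix.of fun i j : Fin n => D^[(i : ℕ)] (b j)) = 0 from
        funext fun j => ha (b j)⟩)
  refine hc0 (D.eq_zero_of_wronskian_relation n b (fun d hd hs => ?_) c fun i hi => ?_)
  · have h := Fintype.linearIndependent_iff.1 b.linearIndependent
      (fun j => ⟨d j, (hF _).2 (hd j)⟩) hs
    exact funext fun j => congrArg Subtype.val (h j)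
  · simpa [Matrix.mulVec, dotProduct, mul_comm] using congrFun hc ⟨i, hi⟩


/-- The pairing `(f, g) ↦ τ(f·g)` on `K` is `F`-bilinear and nondegenerate; in
particular if `τ(f·g) = 0` for all `g` then `f = 0`. -/
theorem differential_trace_pairing_nondegenerate
    (p : ℕ) (hp : p.Prime) (K : Type*) [Field K] [CharP K p]
    (δ : K → K)
    (hadd : ∀ a b : K, δ (a + b) = δ a + δ b)
    (hleib : ∀ a b : K, δ (a * b) = a * δ b + δ a * b)
    (hδ : δ ≠ 0)
    (F : Subfield K) (hF : ∀ x : K, x ∈ F ↔ δ x = 0)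
    [FiniteDimensional F K] (r : ℕ) (hrk : Module.finrank F K = p ^ r)
    (z : ℕ → K) (hzF : ∀ i, i < r → δ (z i) = 0) (hzr : z r = 1)
    (hrel : ∀ x : K, δ^[p ^ r] x + ∑ i ∈ Finset.range r, z i * δ^[p ^ i] x = 0)
    (τ : K → K) (hτ : ∀ a : K, τ a = ∑ i ∈ Finset.range (r + 1), z i * δ^[p ^ i - 1] a) :
    (∀ f₁ f₂ g : K, τ ((f₁ + f₂) * g) = τ (f₁ * g) + τ (f₂ * g)) ∧
    (∀ f g₁ g₂ : K, τ (f * (g₁ + g₂)) = τ (f * g₁) + τ (f * g₂)) ∧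
    (∀ lam f g : K, lam ∈ F →
      τ ((lam * f) * g) = lam * τ (f * g) ∧ τ (f * (lam * g)) = lam * τ (f * g)) ∧
    (∀ f : K, (∀ g : K, τ (f * g) = 0) → f = 0) ∧
    (∀ g : K, (∀ f : K, τ (f * g) = 0) → g = 0) := by
  let D : Derivation ℤ K K := Derivation.mk' (AddMonoidHom.mk' δ hadd).toIntLinearMap
    fun a b => by
      simpa [mul_comm] using hleib a b
  have hD : ⇑D = δ := rfl
  have hiadd : ∀ (n : ℕ) (a b : K), δ^[n] (a + b) = δ^[n] a + δ^[n] b := fun n a b =>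
    Function.Semiconj₂.iterate hadd n a b
  have hτadd : ∀ a b, τ (a + b) = τ a + τ b := fun a b => by
    simp only [hτ, hiadd, mul_add, Finset.sum_add_distrib]
  have hismul : ∀ (n : ℕ) (lam a : K), lam ∈ F → δ^[n] (lam * a) = lam * δ^[n] a := by
    intro n lam a hlam
    have h : Function.Commute δ (lam * ·) := fun x => by
      simp [hleib, (hF lam).1 hlam]
    exact h.iterate_left n a
  have hτsmul : ∀ lam a, lam ∈ F → τ (lam * a) = lam * τ a := fun lam a hlam => by
    simp only [hτ, hismul _ _ _ hlam, Finset.mul_sum, mul_left_comm]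
  have hpos : ∀ i, 1 ≤ p ^ i := fun i => Nat.one_le_pow _ _ hp.pos
  have hτne : ∃ x, τ x ≠ 0 := by
    by_contra! h0
    have ha := D.eq_zero_of_sum_mul_iterate_eq_zero_s17 F hF (p ^ r) hrk
      (fun k => ∑ i ∈ Finset.range (r + 1), if p ^ i - 1 = (k : ℕ) then z i else 0) fun x => by
        refine Eq.trans ?_ ((hτ x).symm.trans (h0 x))
        rw [hD]
        simp only [Finset.sum_mul, ite_mul, zero_mul]
        rw [Finset.sum_comm]
        refine Finset.sum_congr rfl fun i hi => ?_
        have hle : p ^ i ≤ p ^ r :=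
          Nat.pow_le_pow_right hp.pos (Nat.lt_succ_iff.1 (Finset.mem_range.1 hi))
        have hlt : p ^ i - 1 < p ^ r := by have := hpos i; omega
        rw [Finset.sum_eq_single ⟨p ^ i - 1, hlt⟩]
        · simp
        · intro k _ hk
          exact if_neg fun h => hk (Fin.ext h.symm)
        · simp
    have hlast := congrFun ha ⟨p ^ r - 1, by have := hpos r; omega⟩
    simp only [Pi.zero_apply] at hlast
    rw [Finset.sum_eq_single r] at hlast
    · simp [hzr] at hlast
    · intro i _ hi
      refine if_neg fun h => hi (Nat.pow_right_injective hp.two_le ?_)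
      have := hpos i
      have := hpos r
      show p ^ i = p ^ r
      omega
    · simp
  obtain ⟨x, hx⟩ := hτne
  have hnd : ∀ f : K, (∀ g : K, τ (f * g) = 0) → f = 0 := fun f hf => by
    by_contra hf0
    exact hx (by simpa [mul_inv_cancel_left₀ hf0] using hf (f⁻¹ * x))
  refine ⟨fun f₁ f₂ g => by rw [add_mul, hτadd], fun f g₁ g₂ => by rw [mul_add, hτadd],
    fun lam f g hlam => ⟨by rw [mul_assoc, hτsmul _ _ hlam],
      by rw [mul_left_comm, hτsmul _ _ hlam]⟩, hnd, fun g hg => hnd g fun f => ?_⟩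
  rw [mul_comm, hg]
end

section
/- With K, p, δ, F, r, the z_i and τ as in the context: for every c ∈ K, all a_0, …, a_n ∈ K, and all x, y ∈ K, one has τ( (Σ_{i=0}^{n} (μ_c − δ)^i(a_i·x))·y ) = τ( x·(Σ_{i=0}^{n} a_i·(δ + μ_c)^i(y)) ). In other words, the adjoint of the operator Σ_i μ_{a_i} ∘ (δ + μ_c)^i with respect to the bilinear form (x, y) ↦ τ(xy) is the operator Σ_i (μ_c − δ)^i ∘ μ_{a_i}. -/
theorem map_iterate_mul_eq_map_mul_iterate {R S : Type*} [Mul R] {τ : R → S} {A B : R → R}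
    (h : ∀ u v, τ (A u * v) = τ (u * B v)) (i : ℕ) (u v : R) :
    τ (A^[i] u * v) = τ (u * B^[i] v) := by
  induction i generalizing u with
  | zero => rfl
  | succ i ih => rw [Function.iterate_succ_apply, ih, h, Function.iterate_succ_apply']

/-- Adjunction formula, differential case: the adjoint of `Σ_i μ_{a_i} ∘ (δ + μ_c)^i`
with respect to the bilinear form `(x, y) ↦ τ(xy)` is `Σ_i (μ_c − δ)^i ∘ μ_{a_i}`. -/
theorem adjoint_of_evaluation_differential
    (p : ℕ) (hp : p.Prime) (K : Type*) [Field K] [CharP K p]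
    (δ : K → K)
    (hadd : ∀ a b : K, δ (a + b) = δ a + δ b)
    (hleib : ∀ a b : K, δ (a * b) = a * δ b + δ a * b)
    (hδ : δ ≠ 0)
    (F : Subfield K) (hF : ∀ x : K, x ∈ F ↔ δ x = 0)
    [FiniteDimensional F K] (r : ℕ) (hrk : Module.finrank F K = p ^ r)
    (z : ℕ → K) (hzF : ∀ i, i < r → δ (z i) = 0) (hzr : z r = 1)
    (hrel : ∀ x : K, δ^[p ^ r] x + ∑ i ∈ Finset.range r, z i * δ^[p ^ i] x = 0)
    (τ : K → K) (hτ : ∀ a : K, τ a = ∑ i ∈ Finset.range (r + 1), z i * δ^[p ^ i - 1] a) :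
    ∀ (c : K) (n : ℕ) (a : ℕ → K) (x y : K),
      τ ((∑ i ∈ Finset.range (n + 1), (fun w => c * w - δ w)^[i] (a i * x)) * y)
        = τ (x * ∑ i ∈ Finset.range (n + 1), a i * (fun w => δ w + c * w)^[i] y) := by
  intro c n a x y
  have hτ_add (u v : K) : τ (u + v) = τ u + τ v := by
    have hiter (k : ℕ) : δ^[k] (u + v) = δ^[k] u + δ^[k] v :=
      iterate_map_add (AddMonoidHom.mk' δ hadd) k u v
    simp only [hτ, hiter, mul_add, Finset.sum_add_distrib]
  have hτ_sum (f : ℕ → K) (s : Finset ℕ) : τ (∑ i ∈ s, f i) = ∑ i ∈ s, τ (f i) :=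
    map_sum (AddMonoidHom.mk' τ hτ_add) f s
  have hτ_deriv (u : K) : τ (δ u) = 0 := by
    have hsucc (i : ℕ) : δ^[p ^ i - 1] (δ u) = δ^[p ^ i] u := by
      rw [← Function.iterate_succ_apply, Nat.succ_eq_add_one,
        Nat.sub_add_cancel (Nat.one_le_pow _ _ hp.pos)]
    simp only [hτ, hsucc]
    rw [Finset.sum_range_succ, hzr, one_mul, add_comm, hrel]
  have hadj (u v : K) : τ ((c * u - δ u) * v) = τ (u * (δ v + c * v)) := by
    have hsplit : u * (δ v + c * v) = (c * u - δ u) * v + δ (u * v) := by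
      rw [hleib]
      ring
    rw [hsplit, hτ_add, hτ_deriv, add_zero]
  rw [Finset.sum_mul, Finset.mul_sum, hτ_sum, hτ_sum]
  refine Finset.sum_congr rfl fun i _ => ?_
  rw [map_iterate_mul_eq_map_mul_iterate (A := fun w => c * w - δ w) hadj i, mul_assoc,
    mul_left_comm]
end

section
/- Let K, θ, s, F, Tr_{K/F} be as in the context and let c ∈ K be nonzero. For all a_0, …, a_n ∈ K and all x, y ∈ K, one has Tr_{K/F}( (Σ_{i=0}^{n} (θ^{−1} ∘ μ_c)^i(a_i·x))·y ) = Tr_{K/F}( x·(Σ_{i=0}^{n} a_i·(μ_c ∘ θ)^i(y)) ). In other words, the adjoint of the operator Σ_i μ_{a_i} ∘ (μ_c ∘ θ)^i with respect to the trace form (x, y) ↦ Tr_{K/F}(xy) is the operator Σ_i (θ^{−1} ∘ μ_c)^i ∘ μ_{a_i}. -/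
/-- The sum of the first `s` iterates of an additive endomorphism, as an additive map. -/
def sumIterate {M : Type*} [AddCommMonoid M] (f : M →+ M) (s : ℕ) : M →+ M where
  toFun x := ∑ i ∈ Finset.range s, f^[i] x
  map_zero' := by simp [iterate_map_zero]
  map_add' x y := by simp [iterate_map_add, Finset.sum_add_distrib]

theorem sumIterate_apply_map {M : Type*} [AddCommGroup M] (f : M →+ M) (s : ℕ)
    (hs : ∀ x, f^[s] x = x) (x : M) : sumIterate f s (f x) = sumIterate f s x := by
  change ∑ i ∈ Finset.range s, f^[i] (f x) = ∑ i ∈ Finset.range s, f^[i] x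
  have h := (Finset.sum_range_succ' (fun i => f^[i] x) s).symm.trans
    (Finset.sum_range_succ (fun i => f^[i] x) s)
  simpa [hs] using h

/-- If `T` is additive and `θ`-invariant, then `(θ⁻¹ ∘ μ_c)^j` is adjoint to `(μ_c ∘ θ)^j` for
the form `(x, y) ↦ T (x * y)`. -/
theorem map_iterate_symm_mul {K M : Type*} [CommSemiring K] [AddCommMonoid M] (θ : K ≃+* K)
    (T : K →+ M) (hT : ∀ x, T (θ x) = T x) (c : K) (j : ℕ) (x y : K) :
    T ((fun w => θ.symm (c * w))^[j] x * y) = T (x * (fun w => c * θ w)^[j] y) := by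
  induction j generalizing x y with
  | zero => rfl
  | succ j ih =>
    rw [Function.iterate_succ_apply, ih, Function.iterate_succ_apply', ← hT, map_mul,
      RingEquiv.apply_symm_apply, mul_assoc, mul_left_comm]


/-- Adjunction formula, endomorphic case: the adjoint of `Σ_i μ_{a_i} ∘ (μ_c ∘ θ)^i`
with respect to the trace form `(x, y) ↦ Tr_{K/F}(xy)` is `Σ_i (θ⁻¹ ∘ μ_c)^i ∘ μ_{a_i}`. -/
theorem adjoint_of_evaluation_endomorphic
    (K : Type*) [Field K] (θ : K ≃+* K) (s : ℕ) (hs : 2 ≤ s)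
    (hord : ∀ x : K, (⇑θ)^[s] x = x)
    (hord' : ∀ i : ℕ, 0 < i → i < s → ∃ x : K, (⇑θ)^[i] x ≠ x)
    (F : Subfield K) (hF : ∀ x : K, x ∈ F ↔ θ x = x)
    (c : K) (hc : c ≠ 0) :
    ∀ (n : ℕ) (a : ℕ → K) (x y : K),
      (∑ i ∈ Finset.range s,
        (⇑θ)^[i] ((∑ j ∈ Finset.range (n + 1), (fun w => θ.symm (c * w))^[j] (a j * x)) * y))
      = (∑ i ∈ Finset.range s,
        (⇑θ)^[i] (x * ∑ j ∈ Finset.range (n + 1), a j * (fun w => c * θ w)^[j] y)) := by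
  intro n a x y
  let T : K →+ K := sumIterate (θ : K →+ K) s
  change T _ = T _
  rw [Finset.sum_mul, Finset.mul_sum, map_sum, map_sum]
  refine Finset.sum_congr rfl fun j _ => ?_
  rw [map_iterate_symm_mul θ T (sumIterate_apply_map (θ : K →+ K) s hord), mul_left_comm,
    mul_assoc]
end
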